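/- For vector bundles E, F of ranks e, f over a smooth variety (equivalently, as an identity of symmetric functions in Chern roots x₁,…,x_e and y₁,…,y_f): ∏_{i,j}(1 + x_i + y_j) = ∑_{λ,μ} P_{λ,μ}(e,f) · s_λ(x) · s_μ(y), where P_{λ,μ}(e,f) = ∑_ν c^{ν*}_{λ*,μ} (e|ν−λ)(f|ν*−μ)/h(ν). -/

import Mathlib

open scoped Classical BigOperators
noncomputable section

namespace ChernTensor

/-- The rectangular Young diagram with `r` rows each of length `c`. -/
def rect (r c : ℕ) : YoungDiagram :=
  ⟨Finset.range r ×ˢ Finset.range c, by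
    intro p q hle hp
    simp only [Finset.coe_product, Set.mem_prod, Finset.mem_coe, Finset.mem_range] at hp ⊢
    exact ⟨lt_of_le_of_lt hle.1 hp.1, lt_of_le_of_lt hle.2 hp.2⟩⟩

/-- The complement of a diagram `d` (rotated by 180°) inside the rectangle
with `r` rows and `c` columns. -/
def complIn (r c : ℕ) (d : YoungDiagram) : YoungDiagram :=
  ⟨(Finset.range r ×ˢ Finset.range c).filter
      (fun p => (r - 1 - p.1, c - 1 - p.2) ∉ d), by
    intro p q hle hp
    simp only [Finset.coe_filter, Set.mem_setOf_eq, Finset.mem_product,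
      Finset.mem_range] at hp ⊢
    refine ⟨⟨lt_of_le_of_lt hle.1 hp.1.1, lt_of_le_of_lt hle.2 hp.1.2⟩, fun hq => hp.2 ?_⟩
    exact d.isLowerSet (Prod.mk_le_mk.mpr ⟨Nat.sub_le_sub_left hle.1 _,
      Nat.sub_le_sub_left hle.2 _⟩) hq⟩

/-- The complement `e×f − ν̃ = (e − ν*_f, …, e − ν*_1)` of `ν` in the rectangle
with `f` rows each of length `e` (the paper's `e×f`). -/
def rectCompl (e f : ℕ) (ν : YoungDiagram) : YoungDiagram :=
  complIn f e ν.transpose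

/-- The product of the hook lengths of all boxes of a Young diagram, as a rational. -/
def hookProd (ν : YoungDiagram) : ℚ :=
  ∏ c ∈ ν.cells, ((ν.rowLen c.1 + ν.colLen c.2 - c.1 - c.2 - 1 : ℕ) : ℚ)

/-- The content polynomial `(n | ρ) = ∏_{(i,j) ∈ ρ} (n + j − i)` evaluated at `n`. -/
def contPoly (n : ℚ) (ρ : YoungDiagram) : ℚ :=
  ∏ c ∈ ρ.cells, (n + (c.2 : ℚ) - (c.1 : ℚ))

/-- The skew content polynomial `(n | ρ − σ) = ∏_{(i,j) ∈ ρ/σ} (n + j − i)`. -/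
def skewContPoly (n : ℚ) (ρ σ : YoungDiagram) : ℚ :=
  ∏ c ∈ ρ.cells \ σ.cells, (n + (c.2 : ℚ) - (c.1 : ℚ))

/-- `T : ℕ×ℕ → ℕ` is a Littlewood–Richardson skew tableau of shape `ν/λ` and
content `μ`: entries (≥ 1) exactly on the skew cells, rows weakly increasing,
columns strictly increasing, exactly `μ_k` entries equal to `k` (1-indexed),
and the reverse reading word is a lattice word. -/
def IsLRTableau (lam mu nu : YoungDiagram) (T : ℕ × ℕ → ℕ) : Prop :=
  (∀ c : ℕ × ℕ, c ∈ nu.cells \ lam.cells ↔ T c ≠ 0) ∧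
  (∀ i j j', j ≤ j' → (i, j) ∈ nu.cells \ lam.cells → (i, j') ∈ nu.cells \ lam.cells →
    T (i, j) ≤ T (i, j')) ∧
  (∀ i i' j, i < i' → (i, j) ∈ nu.cells \ lam.cells → (i', j) ∈ nu.cells \ lam.cells →
    T (i, j) < T (i', j)) ∧
  (∀ k : ℕ, ((nu.cells \ lam.cells).filter (fun c => T c = k + 1)).card = mu.rowLen k) ∧
  (∀ c ∈ nu.cells \ lam.cells, ∀ k : ℕ,
    (((nu.cells \ lam.cells).filter
        (fun d => (d.1 < c.1 ∨ (d.1 = c.1 ∧ c.2 ≤ d.2)) ∧ T d = k + 2)).card ≤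
     ((nu.cells \ lam.cells).filter
        (fun d => (d.1 < c.1 ∨ (d.1 = c.1 ∧ c.2 ≤ d.2)) ∧ T d = k + 1)).card))

/-- The Littlewood–Richardson coefficient `c^ν_{λμ}`, defined as the number of
Littlewood–Richardson skew tableaux of shape `ν/λ` and content `μ`. -/
def lrCoeff (lam mu nu : YoungDiagram) : ℕ :=
  if lam ≤ nu then Nat.card {T : ℕ × ℕ → ℕ // IsLRTableau lam mu nu T} else 0

/-- The universal coefficient `P_{λ,μ}(e,f) = ∑_ν c^{ν*}_{λ*,μ} (e|ν−λ)(f|ν*−μ)/h(ν)`. -/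
def P (lam mu : YoungDiagram) (e f : ℚ) : ℚ :=
  ∑ᶠ nu : YoungDiagram, (lrCoeff lam.transpose mu nu.transpose : ℚ) *
    skewContPoly e nu lam * skewContPoly f nu.transpose mu / hookProd nu

/-- A semistandard filling of the cells of `lam` with values in `Fin n`:
weakly increasing along rows, strictly increasing down columns. -/
def IsSSYT (lam : YoungDiagram) {n : ℕ} (T : lam.cells → Fin n) : Prop :=
  (∀ a b : lam.cells, (a : ℕ × ℕ).1 = (b : ℕ × ℕ).1 → (a : ℕ × ℕ).2 ≤ (b : ℕ × ℕ).2 →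
    T a ≤ T b) ∧
  (∀ a b : lam.cells, (a : ℕ × ℕ).2 = (b : ℕ × ℕ).2 → (a : ℕ × ℕ).1 < (b : ℕ × ℕ).1 →
    T a < T b)

/-- The Schur polynomial `s_λ(x₁,…,x_n)` evaluated at `x`, as the generating
function of semistandard tableaux. -/
def schur (lam : YoungDiagram) {n : ℕ} (x : Fin n → ℚ) : ℚ :=
  ∑ᶠ T : {T : lam.cells → Fin n // IsSSYT lam T}, ∏ c : lam.cells, x (T.1 c)

/-- The generalized binomial coefficient `C(a, b) = a(a−1)⋯(a−b+1)/b!`. -/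
def gbinom (a : ℚ) (b : ℕ) : ℚ :=
  (∏ i ∈ Finset.range b, (a - i)) / (Nat.factorial b : ℚ)
section Diagrams

theorem ext_rowLen {a b : YoungDiagram} (h : ∀ i, a.rowLen i = b.rowLen i) : a = b := by
  ext ⟨i, j⟩
  simp only [YoungDiagram.mem_cells, YoungDiagram.mem_iff_lt_rowLen, h]

theorem le_iff_rowLen {a b : YoungDiagram} : a ≤ b ↔ ∀ i, a.rowLen i ≤ b.rowLen i := by
  constructor
  · intro h i
    by_contra! hc
    have : (i, b.rowLen i) ∈ b := h (YoungDiagram.mem_iff_lt_rowLen.2 hc)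
    rw [YoungDiagram.mem_iff_lt_rowLen] at this
    omega
  · rintro h ⟨i, j⟩ hc
    have hc' : (i, j) ∈ a := hc
    have : (i, j) ∈ b := by
      rw [YoungDiagram.mem_iff_lt_rowLen] at hc' ⊢
      exact hc'.trans_le (h i)
    exact this

theorem le_iff_colLen {a b : YoungDiagram} : a ≤ b ↔ ∀ i, a.colLen i ≤ b.colLen i := by
  rw [← YoungDiagram.transpose_le_iff, le_iff_rowLen]
  simp only [YoungDiagram.rowLen_transpose]

theorem card_transpose (a : YoungDiagram) : a.transpose.card = a.card := by
  simp [YoungDiagram.card, YoungDiagram.transpose]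

theorem card_eq_sum_rowLen (a : YoungDiagram) {N : ℕ} (hN : a.rowLen N = 0) :
    a.card = ∑ i ∈ Finset.range N, a.rowLen i := by
  rw [YoungDiagram.card, Finset.card_eq_sum_card_fiberwise (f := Prod.fst) (t := Finset.range N)]
  · refine Finset.sum_congr rfl fun i _ => ?_
    rw [YoungDiagram.rowLen_eq_card]
    rfl
  · rintro ⟨i, j⟩ hc
    simp only [Finset.coe_range, Set.mem_Iio]
    by_contra! hc'
    have h1 : (i, j) ∈ a := hc
    rw [YoungDiagram.mem_iff_lt_rowLen] at h1
    have := a.rowLen_anti N i hc'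
    omega

theorem card_eq_sum_colLen (a : YoungDiagram) {N : ℕ} (hN : a.colLen N = 0) :
    a.card = ∑ i ∈ Finset.range N, a.colLen i := by
  rw [← card_transpose, card_eq_sum_rowLen (N := N)] <;> simp [YoungDiagram.rowLen_transpose, hN]

/-- The Young diagram with prescribed antitone, eventually vanishing, row lengths. -/
def ofRows (r : ℕ → ℕ) (hr : Antitone r) (N : ℕ) : YoungDiagram :=
  ⟨(Finset.range N ×ˢ Finset.range (r 0)).filter (fun c => c.2 < r c.1), by
    rintro ⟨i, j⟩ ⟨i', j'⟩ ⟨h1, h2⟩ hp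
    simp only [Finset.coe_filter, Set.mem_ofPred_eq, Finset.mem_product,
      Finset.mem_range] at hp h1 h2 ⊢
    have := hr h1
    omega⟩

theorem rowLen_ofRows (r : ℕ → ℕ) (hr : Antitone r) {N : ℕ} (hN : r N = 0) (i : ℕ) :
    (ofRows r hr N).rowLen i = r i := by
  have key : ∀ j, j < (ofRows r hr N).rowLen i ↔ j < r i := by
    intro j
    rw [← YoungDiagram.mem_iff_lt_rowLen, ← YoungDiagram.mem_cells]
    simp only [ofRows, Finset.mem_filter, Finset.mem_product,
      Finset.mem_range]
    constructor
    · exact fun h => h.2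
    · intro h
      have h0 := hr (Nat.zero_le i)
      refine ⟨⟨?_, by omega⟩, h⟩
      by_contra! hc
      have := hr hc
      omega
  have h1 := key (r i)
  have h2 := key ((ofRows r hr N).rowLen i)
  omega

theorem exists_rowLen_eq_zero (a : YoungDiagram) : a.rowLen (a.colLen 0) = 0 := by
  by_contra h
  have : (a.colLen 0, 0) ∈ a := YoungDiagram.mem_iff_lt_rowLen.2 (by omega)
  rw [YoungDiagram.mem_iff_lt_colLen] at this
  omega

theorem rowLen_eq_zero_iff {a : YoungDiagram} {n : ℕ} : a.rowLen n = 0 ↔ a.colLen 0 ≤ n := by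
  have := YoungDiagram.mem_iff_lt_rowLen (μ := a) (i := n) (j := 0)
  rw [YoungDiagram.mem_iff_lt_colLen] at this
  omega

theorem rowLen_card (a : YoungDiagram) : a.rowLen a.card = 0 := by
  by_contra h
  have h2 : ∀ i ∈ Finset.range (a.card + 1), 1 ≤ a.rowLen i := by
    intro i hi
    have := a.rowLen_anti i a.card (by simpa [Nat.lt_succ_iff] using hi)
    omega
  have h3 := Finset.card_nsmul_le_sum _ _ _ h2
  have h4 : ∑ i ∈ Finset.range (a.card + 1), a.rowLen i ≤ a.card := by
    have := card_eq_sum_rowLen a (N := a.card + 1 + a.colLen 0)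
      (by rw [rowLen_eq_zero_iff]; omega)
    refine le_trans ?_ this.ge
    exact Finset.sum_le_sum_of_subset (Finset.range_mono (by omega))
  have h5 := h3.trans h4
  simp only [smul_eq_mul, mul_one, Finset.card_range] at h5
  omega

theorem mem_rect {r c i j : ℕ} : (i, j) ∈ rect r c ↔ i < r ∧ j < c := by
  rw [← YoungDiagram.mem_cells]
  simp [rect]

theorem le_rect_iff {a : YoungDiagram} {r c : ℕ} :
    a ≤ rect r c ↔ a.rowLen r = 0 ∧ a.colLen c = 0 := by
  constructor
  · intro h
    constructor
    · by_contra hc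
      have : (r, 0) ∈ rect r c := h (YoungDiagram.mem_iff_lt_rowLen.2 (Nat.pos_of_ne_zero hc))
      simp [mem_rect] at this
    · by_contra hc
      have : (0, c) ∈ rect r c := h (YoungDiagram.mem_iff_lt_colLen.2 (Nat.pos_of_ne_zero hc))
      simp [mem_rect] at this
  · rintro ⟨h1, h2⟩ ⟨i, j⟩ hc
    have hc' : (i, j) ∈ a := hc
    have : (i, j) ∈ rect r c := by
      rw [mem_rect]
      have h3 := YoungDiagram.mem_iff_lt_rowLen.1 hc'
      have h4 := YoungDiagram.mem_iff_lt_colLen.1 hc'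
      constructor
      · by_contra! hh
        have := a.rowLen_anti _ _ hh
        omega
      · by_contra! hh
        have := a.colLen_anti _ _ hh
        omega
    exact this

theorem rect_transpose (r c : ℕ) : (rect r c).transpose = rect c r := by
  ext ⟨i, j⟩
  simp [mem_rect, YoungDiagram.mem_transpose, and_comm]

theorem card_rect (r c : ℕ) : (rect r c).card = r * c := by
  simp [rect, YoungDiagram.card]

theorem card_le_card {a b : YoungDiagram} (h : a ≤ b) : a.card ≤ b.card :=
  Finset.card_le_card (YoungDiagram.cells_subset_iff.2 h)

theorem eq_of_le_of_card {a b : YoungDiagram} (h : a ≤ b) (hc : b.card ≤ a.card) : a = b :=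
  YoungDiagram.ext (Finset.eq_of_subset_of_card_le (YoungDiagram.cells_subset_iff.2 h) hc)

theorem finite_le (b : YoungDiagram) : {a : YoungDiagram | a ≤ b}.Finite := by
  refine Set.Finite.of_finite_image (f := YoungDiagram.cells) ?_ ?_
  · refine (b.cells.powerset.finite_toSet).subset ?_
    rintro _ ⟨a, ha, rfl⟩
    simpa using ha
  · intro a _ a' _ h
    exact YoungDiagram.ext h

/-- The finite set of subdiagrams of a Young diagram. -/
def below (b : YoungDiagram) : Finset YoungDiagram := (finite_le b).toFinset

@[simp] theorem mem_below {a b : YoungDiagram} : a ∈ below b ↔ a ≤ b := by simp [below]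

theorem finite_level (n : ℕ) : {a : YoungDiagram | a.card = n}.Finite := by
  refine (finite_le (rect n n)).subset ?_
  rintro a rfl
  refine le_rect_iff.2 ⟨rowLen_card a, ?_⟩
  rw [← YoungDiagram.rowLen_transpose]
  conv_lhs => rw [← card_transpose]
  exact rowLen_card _

/-- The finite set of Young diagrams with `n` boxes. -/
def level (n : ℕ) : Finset YoungDiagram := (finite_level n).toFinset

@[simp] theorem mem_level {a : YoungDiagram} {n : ℕ} : a ∈ level n ↔ a.card = n := by
  simp [level]

/-- `b` is obtained from `a` by adding one box. -/
def Cov (a b : YoungDiagram) : Prop := a ≤ b ∧ b.card = a.card + 1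

theorem Cov.transpose {a b : YoungDiagram} (h : Cov a b) : Cov a.transpose b.transpose :=
  ⟨YoungDiagram.transpose_mono h.1, by rw [card_transpose, card_transpose, h.2]⟩

theorem cov_iff_rowLen {a b : YoungDiagram} :
    Cov a b ↔ ∃ k, ∀ i, b.rowLen i = a.rowLen i + if i = k then 1 else 0 := by
  have hN : ∀ N, a.colLen 0 + b.colLen 0 ≤ N → a.rowLen N = 0 ∧ b.rowLen N = 0 := by
    intro N h
    rw [rowLen_eq_zero_iff, rowLen_eq_zero_iff]
    omega
  constructor
  · rintro ⟨h1, h2⟩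
    rw [le_iff_rowLen] at h1
    rw [card_eq_sum_rowLen a (hN _ le_rfl).1, card_eq_sum_rowLen b (hN _ le_rfl).2] at h2
    set N := a.colLen 0 + b.colLen 0
    have h3 : ∑ i ∈ Finset.range N, (b.rowLen i - a.rowLen i) = 1 := by
      rw [Finset.sum_tsub_distrib _ fun i _ => h1 i]
      omega
    obtain ⟨k, hk, hk2⟩ : ∃ k ∈ Finset.range N, b.rowLen k - a.rowLen k ≠ 0 := by
      by_contra! hc
      rw [Finset.sum_eq_zero hc] at h3
      omega
    refine ⟨k, fun i => ?_⟩
    have h4 := Finset.add_sum_erase _ (fun i => b.rowLen i - a.rowLen i) hk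
    simp only [h3] at h4
    have h1i := h1 i
    split_ifs with hik
    · subst hik; omega
    · by_cases hi : i < N
      · have h5 := Finset.single_le_sum (f := fun i => b.rowLen i - a.rowLen i)
          (fun _ _ => Nat.zero_le _) (Finset.mem_erase.2 ⟨hik, Finset.mem_range.2 hi⟩)
        omega
      · have := hN i (by omega)
        omega
  · rintro ⟨k, hk⟩
    refine ⟨le_iff_rowLen.2 fun i => by rw [hk i]; omega, ?_⟩
    have hkN : k < a.colLen 0 + b.colLen 0 := by
      by_contra! hc
      have h1 := hN k (by omega)
      have h2 := hk k
      simp at h2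
      omega
    rw [card_eq_sum_rowLen a (hN _ le_rfl).1, card_eq_sum_rowLen b (hN _ le_rfl).2,
      Finset.sum_congr rfl fun i _ => hk i, Finset.sum_add_distrib, Finset.sum_ite_eq']
    simp [hkN]

theorem Cov.sdiff_eq {a b : YoungDiagram} {k : ℕ}
    (hk : ∀ i, b.rowLen i = a.rowLen i + if i = k then 1 else 0) :
    b.cells \ a.cells = {(k, a.rowLen k)} := by
  ext ⟨i, j⟩
  simp only [Finset.mem_sdiff, YoungDiagram.mem_cells, YoungDiagram.mem_iff_lt_rowLen, hk i,
    Finset.mem_singleton, Prod.mk.injEq]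
  split_ifs with h
  · subst h; simp; omega
  · simp [h]

theorem skewContPoly_cov {a b : YoungDiagram} {k : ℕ} (n : ℚ)
    (hk : ∀ i, b.rowLen i = a.rowLen i + if i = k then 1 else 0) :
    skewContPoly n b a = n + (a.rowLen k : ℚ) - k := by
  rw [skewContPoly, Cov.sdiff_eq hk, Finset.prod_singleton]

theorem skewContPoly_transpose_cov {a b : YoungDiagram} {k : ℕ} (n : ℚ)
    (hk : ∀ i, b.rowLen i = a.rowLen i + if i = k then 1 else 0) :
    skewContPoly n b.transpose a.transpose = n + k - (a.rowLen k : ℚ) := by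
  have : b.transpose.cells \ a.transpose.cells = {(a.rowLen k, k)} := by
    ext ⟨i, j⟩
    have h := Finset.ext_iff.1 (Cov.sdiff_eq hk) (j, i)
    simp only [Finset.mem_sdiff, YoungDiagram.mem_cells, Finset.mem_singleton, Prod.mk.injEq,
      YoungDiagram.mem_transpose, Prod.swap_prod_mk] at h ⊢
    rw [h, and_comm]
  rw [skewContPoly, this, Finset.prod_singleton]

theorem skewContPoly_mul (n : ℚ) {a b c : YoungDiagram} (hab : a ≤ b) (hbc : b ≤ c) :
    skewContPoly n c b * skewContPoly n b a = skewContPoly n c a := by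
  rw [← YoungDiagram.cells_subset_iff] at hab hbc
  rw [skewContPoly, skewContPoly, skewContPoly, ← Finset.prod_union]
  · congr 1
    ext x
    simp only [Finset.mem_union, Finset.mem_sdiff]
    have := @hab x
    have := @hbc x
    tauto
  · rw [Finset.disjoint_left]
    intro x
    simp only [Finset.mem_sdiff]
    tauto

end Diagrams
section LRChains

/-- A Littlewood–Richardson tableau of shape `b/a` and content `g`, encoded by the row lengths
`R i j` of the subdiagrams of entries at most `i`. -/
structure LRChain (a g b : YoungDiagram) (R : ℕ → ℕ → ℕ) : Prop where
  zero : ∀ j, R 0 j = a.rowLen j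
  mono : ∀ i j, R i j ≤ R (i + 1) j
  strip : ∀ i j, R (i + 1) (j + 1) ≤ R i j
  top : ∀ i, g.colLen 0 ≤ i → ∀ j, R i j = b.rowLen j
  content : ∃ J₀, ∀ J, J₀ ≤ J → ∀ i,
    ∑ j ∈ Finset.range J, R (i + 1) j = ∑ j ∈ Finset.range J, R i j + g.rowLen i
  lattice : ∀ i j, ∑ j' ∈ Finset.range (j + 1), R (i + 2) j' + ∑ j' ∈ Finset.range j, R i j' ≤
    ∑ j' ∈ Finset.range j, R (i + 1) j' + ∑ j' ∈ Finset.range (j + 1), R (i + 1) j'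

/-- A jeu de taquin slide from `R` to `R'`, along the boxes at the end of row `r i` of `R i`. -/
structure Slide (R R' : ℕ → ℕ → ℕ) (r : ℕ → ℕ) : Prop where
  rel : ∀ i j, R i j = R' i j + if j = r i then 1 else 0
  step : ∀ i, (r (i + 1) = r i + 1 ∧ R (i + 1) (r i + 1) = R i (r i)) ∨
    (r (i + 1) = r i ∧ R (i + 1) (r i + 1) < R i (r i))

theorem Slide.sum_eq {R R' : ℕ → ℕ → ℕ} {r : ℕ → ℕ} (h : Slide R R' r) (i J : ℕ) :
    ∑ j ∈ Finset.range J, R i j = ∑ j ∈ Finset.range J, R' i j + if r i < J then 1 else 0 := by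
  simp only [h.rel i, Finset.sum_add_distrib, Finset.sum_ite_eq', Finset.mem_range]

theorem Slide.le_add {R R' : ℕ → ℕ → ℕ} {r : ℕ → ℕ} (h : Slide R R' r) (i : ℕ) :
    r (i + 1) = r i + 1 ∨ r (i + 1) = r i := (h.step i).imp And.left And.left

theorem Slide.bounded {R R' : ℕ → ℕ → ℕ} {r : ℕ → ℕ} (h : Slide R R' r) {K k : ℕ}
    (hr : ∀ i, K ≤ i → r i = k) (i : ℕ) : r i ≤ k := by
  have hm : Monotone r := monotone_nat_of_le_succ fun i => by
    rcases h.le_add i with h | h <;> omega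
  rw [← hr (i + K) (by omega)]
  exact hm (by omega)

theorem Slide.content_iff {R R' : ℕ → ℕ → ℕ} {r g : ℕ → ℕ} (h : Slide R R' r) {K k : ℕ}
    (hr : ∀ i, K ≤ i → r i = k) :
    (∃ J₀, ∀ J, J₀ ≤ J → ∀ i,
      ∑ j ∈ Finset.range J, R (i + 1) j = ∑ j ∈ Finset.range J, R i j + g i) ↔
    (∃ J₀, ∀ J, J₀ ≤ J → ∀ i,
      ∑ j ∈ Finset.range J, R' (i + 1) j = ∑ j ∈ Finset.range J, R' i j + g i) := by
  constructor <;>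
  · rintro ⟨J₀, hJ⟩
    refine ⟨J₀ + k + 1, fun J hJ' i => ?_⟩
    have h1 := hJ J (by omega) i
    have h2 := h.bounded hr i
    have h3 := h.bounded hr (i + 1)
    have h4 := h.sum_eq i J
    have h5 := h.sum_eq (i + 1) J
    rw [if_pos (by omega)] at h4 h5
    omega

theorem Slide.lattice {R R' : ℕ → ℕ → ℕ} {r : ℕ → ℕ} (h : Slide R R' r)
    (hl : ∀ i j, ∑ j' ∈ Finset.range (j + 1), R (i + 2) j' + ∑ j' ∈ Finset.range j, R i j' ≤
      ∑ j' ∈ Finset.range j, R (i + 1) j' + ∑ j' ∈ Finset.range (j + 1), R (i + 1) j')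
    (i j : ℕ) : ∑ j' ∈ Finset.range (j + 1), R' (i + 2) j' + ∑ j' ∈ Finset.range j, R' i j' ≤
      ∑ j' ∈ Finset.range j, R' (i + 1) j' + ∑ j' ∈ Finset.range (j + 1), R' (i + 1) j' := by
  have h1 := hl i j
  have h2 := hl i (j + 1)
  have s1 := h.step i
  have s2 : (r (i + 2) = r (i + 1) + 1 ∧ R (i + 2) (r (i + 1) + 1) = R (i + 1) (r (i + 1))) ∨
    (r (i + 2) = r (i + 1) ∧ R (i + 2) (r (i + 1) + 1) < R (i + 1) (r (i + 1))) := h.step (i + 1)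
  have e1 := h.sum_eq (i + 2) (j + 1)
  have e2 := h.sum_eq i j
  have e3 := h.sum_eq (i + 1) j
  have e4 := h.sum_eq (i + 1) (j + 1)
  rw [Finset.sum_range_succ _ (j + 1), Finset.sum_range_succ _ (j + 1),
    Finset.sum_range_succ (fun j' => R i j') j] at h2
  have h3 := Finset.sum_range_succ (fun j' => R (i + 1) j') j
  by_cases hj : r (i + 1) = j
  · subst hj
    rcases s1 with ⟨s1, s1'⟩ | ⟨s1, s1'⟩ <;> rcases s2 with ⟨s2, s2'⟩ | ⟨s2, s2'⟩ <;>
      simp only [s1, s2, add_assoc, Nat.reduceAdd] at * <;> split_ifs at * <;> omega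
  · split_ifs at * <;> omega

theorem Slide.lattice_symm {R R' : ℕ → ℕ → ℕ} {r : ℕ → ℕ} (h : Slide R R' r)
    (hs : ∀ i j, R (i + 1) (j + 1) ≤ R i j)
    (hl : ∀ i j, ∑ j' ∈ Finset.range (j + 1), R' (i + 2) j' + ∑ j' ∈ Finset.range j, R' i j' ≤
      ∑ j' ∈ Finset.range j, R' (i + 1) j' + ∑ j' ∈ Finset.range (j + 1), R' (i + 1) j')
    (i j : ℕ) : ∑ j' ∈ Finset.range (j + 1), R (i + 2) j' + ∑ j' ∈ Finset.range j, R i j' ≤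
      ∑ j' ∈ Finset.range j, R (i + 1) j' + ∑ j' ∈ Finset.range (j + 1), R (i + 1) j' := by
  have h1 := hl i j
  have s1 := h.step i
  have s2 : (r (i + 2) = r (i + 1) + 1 ∧ R (i + 2) (r (i + 1) + 1) = R (i + 1) (r (i + 1))) ∨
    (r (i + 2) = r (i + 1) ∧ R (i + 2) (r (i + 1) + 1) < R (i + 1) (r (i + 1))) := h.step (i + 1)
  have e1 := h.sum_eq (i + 2) (j + 1)
  have e2 := h.sum_eq i j
  have e3 := h.sum_eq (i + 1) j
  have e4 := h.sum_eq (i + 1) (j + 1)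
  by_cases hj : r (i + 1) = j ∧ r i + 1 = j ∧ r (i + 2) = j
  · obtain ⟨hj1, hj2, hj3⟩ := hj
    subst hj2
    have h2 := hl i (r i)
    have h3 := hs (i + 1) (r i)
    have f1 := h.rel (i + 2) (r i + 1)
    have f2 := h.rel (i + 1) (r i)
    have f3 := h.rel (i + 1) (r i + 1)
    have f4 := h.rel i (r i)
    have s1' : R (i + 1) (r i + 1) = R i (r i) := by
      rcases s1 with s1 | s1
      · exact s1.2
      · omega
    simp only [hj1, hj3, add_assoc, Nat.reduceAdd] at *
    rw [Finset.sum_range_succ _ (r i + 1),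
      Finset.sum_range_succ (fun j' => R' (i + 1) j') (r i + 1),
      Finset.sum_range_succ (fun j' => R' i j') (r i)] at h1
    rw [Finset.sum_range_succ (fun j' => R' (i + 1) j') (r i)] at h1 h2
    rw [Finset.sum_range_succ (fun j' => R' (i + 2) j') (r i + 1)] at e1
    rw [Finset.sum_range_succ (fun j' => R' i j') (r i)] at e2
    rw [Finset.sum_range_succ (fun j' => R' (i + 1) j') (r i)] at e3
    rw [Finset.sum_range_succ (fun j' => R' (i + 1) j') (r i + 1),
      Finset.sum_range_succ (fun j' => R' (i + 1) j') (r i)] at e4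
    split_ifs at * <;> omega
  · split_ifs at * <;> omega

/-- The rows visited by the slide of `R` into the end of row `k`. -/
def slideRow (R : ℕ → ℕ → ℕ) (k : ℕ) : ℕ → ℕ
  | 0 => k
  | i + 1 => if R (i + 1) (slideRow R k i + 1) = R i (slideRow R k i) then slideRow R k i + 1
    else slideRow R k i

/-- The rows visited by the reverse slide of `R` from the end of row `k` of `R K`, read
backwards. -/
def unslideRow (R : ℕ → ℕ → ℕ) (K k : ℕ) : ℕ → ℕ
  | 0 => k
  | n + 1 => if 0 < unslideRow R K k n ∧
      R (K - n) (unslideRow R K k n) = R (K - n - 1) (unslideRow R K k n - 1)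
    then unslideRow R K k n - 1 else unslideRow R K k n

theorem LRChain.exists_slide {a a' g b : YoungDiagram} {R : ℕ → ℕ → ℕ} (h : LRChain a' g b R)
    (ha : Cov a a') : ∃ R' r b', Slide R R' r ∧ Cov b' b ∧ LRChain a g b' R' := by
  obtain ⟨k, hk⟩ := cov_iff_rowLen.1 ha
  set r := slideRow R k with hrdef
  have hr0 : r 0 = k := rfl
  have hr1 : ∀ i, r (i + 1) = if R (i + 1) (r i + 1) = R i (r i) then r i + 1 else r i :=
    fun i => rfl
  have hstep : ∀ i, (r (i + 1) = r i + 1 ∧ R (i + 1) (r i + 1) = R i (r i)) ∨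
    (r (i + 1) = r i ∧ R (i + 1) (r i + 1) < R i (r i)) := by
    intro i
    have h1 := hr1 i
    have h2 := h.strip i (r i)
    split_ifs at h1 with h3 <;> omega
  have hcorner : ∀ i, R i (r i + 1) < R i (r i) := by
    intro i
    induction i with
    | zero =>
      rw [h.zero, h.zero, hr0, hk, hk]
      have := a.rowLen_anti k (k + 1) (by omega)
      simp
      omega
    | succ i ih =>
      have h1 := h.strip i (r i + 1)
      have h2 := h.mono i (r i)
      rcases hstep i with ⟨h3, h4⟩ | ⟨h3, h4⟩ <;> rw [h3] <;> omega
  set R' : ℕ → ℕ → ℕ := fun i j => R i j - if j = r i then 1 else 0 with hR'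
  have hs : Slide R R' r := by
    refine ⟨fun i j => ?_, hstep⟩
    have := hcorner i
    simp only [hR']
    split_ifs with hj
    · subst hj; omega
    · omega
  have hmono : ∀ i j, R' i j ≤ R' (i + 1) j := by
    intro i j
    have h1 := h.mono i j
    have h2 := hcorner i
    have h5 := hs.rel i j
    have h6 := hs.rel (i + 1) j
    rcases hstep i with ⟨h3, h4⟩ | ⟨h3, h4⟩ <;> rw [h3] at h6
    · by_cases hj : j = r i + 1
      · subst hj; split_ifs at * <;> omega
      · split_ifs at * <;> omega
    · split_ifs at * <;> omega
  have hstrip : ∀ i j, R' (i + 1) (j + 1) ≤ R' i j := by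
    intro i j
    have h1 := h.strip i j
    have h5 := hs.rel i j
    have h6 := hs.rel (i + 1) (j + 1)
    rcases hstep i with ⟨h3, h4⟩ | ⟨h3, h4⟩ <;> rw [h3] at h6
    · split_ifs at * <;> omega
    · by_cases hj : j = r i
      · subst hj; split_ifs at * <;> omega
      · split_ifs at * <;> omega
  set K := g.colLen 0 with hK
  have hstab : ∀ i, K ≤ i → r i = r K := by
    intro i hi
    induction i, hi using Nat.le_induction with
    | base => rfl
    | succ i hi ih =>
      have h1 := hcorner i
      rw [h.top _ hi, h.top _ hi] at h1
      have h2 := hstep i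
      rw [h.top _ hi, h.top (i + 1) (by omega)] at h2
      omega
  have hbK : ∀ j, R' K j ≤ b.rowLen j := by
    intro j
    have := hs.rel K j
    rw [h.top K le_rfl j] at this
    omega
  have hanti : Antitone (R' K) :=
    antitone_nat_of_succ_le fun j => (hmono K (j + 1)).trans (hstrip K j)
  have hz : R' K (b.colLen 0) = 0 := by
    have := hbK (b.colLen 0)
    rw [exists_rowLen_eq_zero] at this
    omega
  have hrow := rowLen_ofRows _ hanti hz
  refine ⟨R', r, ofRows (R' K) hanti (b.colLen 0), hs, ?_, ?_, hmono, hstrip, ?_,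
    (hs.content_iff hstab).1 h.content, hs.lattice h.lattice⟩
  · refine cov_iff_rowLen.2 ⟨r K, fun i => ?_⟩
    rw [hrow, ← hs.rel, h.top K le_rfl]
  · intro j
    have h1 := hs.rel 0 j
    have h2 := hk j
    rw [h.zero, hr0] at h1
    omega
  · intro i hi j
    rw [hrow]
    have h1 := hs.rel i j
    have h2 := hs.rel K j
    rw [h.top i hi, hstab i hi] at h1
    rw [h.top K le_rfl] at h2
    omega

theorem LRChain.exists_unslide {a g b b' : YoungDiagram} {R' : ℕ → ℕ → ℕ}
    (h : LRChain a g b' R') (hb : Cov b' b) :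
    ∃ R r a', Slide R R' r ∧ Cov a a' ∧ LRChain a' g b R := by
  obtain ⟨k, hk⟩ := cov_iff_rowLen.1 hb
  set K := g.colLen 0 with hK
  obtain ⟨r, hr⟩ : ∃ r : ℕ → ℕ, ∀ i, r i = unslideRow R' K k (K - i) := ⟨_, fun _ => rfl⟩
  have hstab : ∀ i, K ≤ i → r i = k := by
    intro i hi
    rw [hr, Nat.sub_eq_zero_of_le hi]
    rfl
  have hback : ∀ i, i < K → r i = if 0 < r (i + 1) ∧
      R' (i + 1) (r (i + 1)) = R' i (r (i + 1) - 1) then r (i + 1) - 1 else r (i + 1) := by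
    intro i hi
    obtain ⟨n, hn⟩ : ∃ n, K = i + n + 1 := ⟨K - i - 1, by omega⟩
    rw [hr, hr, show K - i = n + 1 by omega, show K - (i + 1) = n by omega, unslideRow,
      show K - n = i + 1 by omega, Nat.add_sub_cancel]
  have hcorner : ∀ i, ∀ m, r i = m + 1 → R' i (m + 1) < R' i m := by
    have hge : ∀ i, K ≤ i → ∀ m, r i = m + 1 → R' i (m + 1) < R' i m := by
      intro i hi m hm
      rw [hstab i hi] at hm
      rw [h.top i hi, h.top i hi]
      have h1 := b.rowLen_anti m (m + 1) (by omega)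
      rw [hk, hk] at h1
      split_ifs at h1 <;> omega
    have hlt : ∀ n, ∀ i, i + n = K → ∀ m, r i = m + 1 → R' i (m + 1) < R' i m := by
      intro n
      induction n with
      | zero => exact fun i hi => hge i (by omega)
      | succ n ih =>
        intro i hi m hm
        have h1 := hback i (by omega)
        have h2 := ih (i + 1) (by omega)
        have h3 := h.strip i m
        have h4 := h.mono i (m + 1)
        split_ifs at h1 with hc
        · have h5 := h2 (m + 1) (by omega)
          rw [show r (i + 1) = m + 1 + 1 by omega] at hc
          simp only [Nat.add_sub_cancel] at hc
          omega
        · rw [← h1, hm] at hc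
          simp only [Nat.add_sub_cancel] at hc
          omega
    intro i
    by_cases hi : K ≤ i
    · exact hge i hi
    · exact hlt (K - i) i (by omega)
  obtain ⟨R, hR⟩ : ∃ R : ℕ → ℕ → ℕ, ∀ i j, R i j = R' i j + if j = r i then 1 else 0 :=
    ⟨_, fun _ _ => rfl⟩
  have hcase : ∀ i, (r (i + 1) = r i + 1 ∧ R' (i + 1) (r i + 1) = R' i (r i)) ∨
      (r (i + 1) = r i ∧ ∀ m, r i = m + 1 → R' (i + 1) (m + 1) < R' i m) := by
    intro i
    by_cases hi : i < K
    · have h1 := hback i hi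
      split_ifs at h1 with hc
      · left
        have h2 : r (i + 1) = r i + 1 := by omega
        rw [h2, Nat.add_sub_cancel] at hc
        exact ⟨h2, hc.2⟩
      · right
        refine ⟨h1.symm, fun m hm => ?_⟩
        rw [← h1, hm] at hc
        simp only [Nat.add_sub_cancel] at hc
        have := h.strip i m
        omega
    · right
      refine ⟨by rw [hstab i (by omega), hstab (i + 1) (by omega)], fun m hm => ?_⟩
      have := hcorner i m hm
      rw [h.top i (by omega), h.top i (by omega)] at this
      rw [h.top i (by omega), h.top (i + 1) (by omega)]
      omega
  have hs : Slide R R' r := by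
    refine ⟨hR, fun i => ?_⟩
    have h1 := hR i (r i)
    have h2 := hR (i + 1) (r i + 1)
    have h3 := h.strip i (r i)
    rcases hcase i with ⟨h4, h5⟩ | ⟨h4, h5⟩
    · left
      refine ⟨h4, ?_⟩
      rw [h4] at h2
      simp only [if_true] at h1 h2
      omega
    · right
      refine ⟨h4, ?_⟩
      rw [h4] at h2
      simp at h1 h2
      omega
  have hmono : ∀ i j, R i j ≤ R (i + 1) j := by
    intro i j
    have h1 := h.mono i j
    have h5 := hR i j
    have h6 := hR (i + 1) j
    have h7 := hcorner (i + 1) (r i)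
    rcases hcase i with ⟨h3, h4⟩ | ⟨h3, h4⟩ <;> rw [h3] at h6
    · have h7 := h7 h3
      by_cases hj : j = r i
      · subst hj; split_ifs at * <;> omega
      · split_ifs at * <;> omega
    · split_ifs at * <;> omega
  have hstrip : ∀ i j, R (i + 1) (j + 1) ≤ R i j := by
    intro i j
    have h1 := h.strip i j
    have h5 := hR i j
    have h6 := hR (i + 1) (j + 1)
    rcases hcase i with ⟨h3, h4⟩ | ⟨h3, h4⟩ <;> rw [h3] at h6
    · split_ifs at * <;> omega
    · by_cases hj : r i = j + 1
      · have := h4 j hj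
        split_ifs at * <;> omega
      · split_ifs at * <;> omega
  have htop : ∀ i, K ≤ i → ∀ j, R i j = b.rowLen j := by
    intro i hi j
    rw [hR, h.top i hi, hstab i hi, hk]
  have hle : ∀ i j, R i j ≤ b.rowLen j := by
    intro i j
    rw [← htop (i + K) (by omega)]
    exact monotone_nat_of_le_succ (f := fun i => R i j) (fun i => hmono i j) (by omega)
  have hanti : Antitone (R 0) :=
    antitone_nat_of_succ_le fun j => (hmono 0 (j + 1)).trans (hstrip 0 j)
  have hz : R 0 (b.colLen 0) = 0 := by
    have := hle 0 (b.colLen 0)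
    rw [exists_rowLen_eq_zero] at this
    omega
  have hrow := rowLen_ofRows _ hanti hz
  refine ⟨R, r, ofRows (R 0) hanti (b.colLen 0), hs, ?_, fun j => (hrow j).symm, hmono, hstrip,
    htop, (hs.content_iff hstab).2 h.content, hs.lattice_symm hstrip h.lattice⟩
  refine cov_iff_rowLen.2 ⟨r 0, fun i => ?_⟩
  rw [hrow, hR, h.zero]

theorem LRChain.le_top {a g b : YoungDiagram} {R : ℕ → ℕ → ℕ} (h : LRChain a g b R) (i j : ℕ) :
    R i j ≤ b.rowLen j := by
  rw [← h.top (i + g.colLen 0) (by omega)]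
  exact monotone_nat_of_le_succ (f := fun i => R i j) (fun i => h.mono i j) (by omega)

theorem LRChain.le {a g b : YoungDiagram} {R : ℕ → ℕ → ℕ} (h : LRChain a g b R) : a ≤ b :=
  le_iff_rowLen.2 fun j => by rw [← h.zero]; exact h.le_top 0 j

theorem Slide.unique {R R₁ R₂ : ℕ → ℕ → ℕ} {r₁ r₂ : ℕ → ℕ} (h₁ : Slide R R₁ r₁)
    (h₂ : Slide R R₂ r₂) (h0 : ∀ j, R₁ 0 j = R₂ 0 j) : R₁ = R₂ := by
  have hr : ∀ i, r₁ i = r₂ i := by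
    intro i
    induction i with
    | zero =>
      have e1 := h₁.rel 0 (r₁ 0)
      have e2 := h₂.rel 0 (r₁ 0)
      have e3 := h0 (r₁ 0)
      by_contra hc
      simp [hc] at e1 e2
      omega
    | succ i ih =>
      have s1 := h₁.step i
      have s2 := h₂.step i
      rw [ih] at s1
      omega
  funext i j
  have e1 := h₁.rel i j
  have e2 := h₂.rel i j
  rw [hr] at e1
  omega

theorem Slide.unique_symm {R R₁ R₂ : ℕ → ℕ → ℕ} {r₁ r₂ : ℕ → ℕ} (h₁ : Slide R₁ R r₁)
    (h₂ : Slide R₂ R r₂) (hs₁ : ∀ i j, R₁ (i + 1) (j + 1) ≤ R₁ i j)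
    (hs₂ : ∀ i j, R₂ (i + 1) (j + 1) ≤ R₂ i j) {K : ℕ}
    (hK : ∀ i, K ≤ i → ∀ j, R₁ i j = R₂ i j) : R₁ = R₂ := by
  have hge : ∀ i, K ≤ i → r₁ i = r₂ i := by
    intro i hi
    have e1 := h₁.rel i (r₁ i)
    have e2 := h₂.rel i (r₁ i)
    have e3 := hK i hi (r₁ i)
    by_contra hc
    simp [hc] at e1 e2
    omega
  have hlt : ∀ n i, K ≤ i + n → r₁ i = r₂ i := by
    intro n
    induction n with
    | zero => exact fun i hi => hge i hi
    | succ n ih =>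
      intro i hi
      have h3 := ih (i + 1) (by omega)
      have s1 := h₁.step i
      have s2 := h₂.step i
      by_contra hc
      rcases s1 with s1 | s1 <;> rcases s2 with s2 | s2
      · omega
      · have e := hs₂ i (r₁ i)
        have e1 := h₁.rel i (r₁ i)
        have e2 := h₁.rel (i + 1) (r₁ i + 1)
        have e3 := h₂.rel i (r₁ i)
        have e4 := h₂.rel (i + 1) (r₁ i + 1)
        split_ifs at * <;> omega
      · have e := hs₁ i (r₂ i)
        have e1 := h₂.rel i (r₂ i)
        have e2 := h₂.rel (i + 1) (r₂ i + 1)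
        have e3 := h₁.rel i (r₂ i)
        have e4 := h₁.rel (i + 1) (r₂ i + 1)
        split_ifs at * <;> omega
      · omega
  funext i j
  have e1 := h₁.rel i j
  have e2 := h₂.rel i j
  rw [hlt K i (by omega)] at e1
  omega

end LRChains

section LRTableaux

/-- `R i j` is the number of boxes of row `j` of `b` with entry at most `i` in `T`, where the boxes
of row `j` with entry at most `i` form an initial segment. -/
def RowCount (b : YoungDiagram) (T : ℕ × ℕ → ℕ) (R : ℕ → ℕ → ℕ) : Prop :=
  ∀ i j c, c < R i j ↔ c < b.rowLen j ∧ T (j, c) ≤ i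

theorem mem_sdiff_iff {a b : YoungDiagram} {j c : ℕ} :
    (j, c) ∈ b.cells \ a.cells ↔ a.rowLen j ≤ c ∧ c < b.rowLen j := by
  rw [Finset.mem_sdiff, YoungDiagram.mem_cells, YoungDiagram.mem_cells,
    YoungDiagram.mem_iff_lt_rowLen, YoungDiagram.mem_iff_lt_rowLen]
  omega

theorem RowCount.card_add {a b : YoungDiagram} {T : ℕ × ℕ → ℕ} {R : ℕ → ℕ → ℕ}
    (h : RowCount b T R) (h0 : ∀ j, R 0 j = a.rowLen j) (m J : ℕ) :
    ((b.cells \ a.cells).filter (fun d => d.1 < J ∧ T d = m + 1)).card +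
      ∑ j ∈ Finset.range J, R m j = ∑ j ∈ Finset.range J, R (m + 1) j := by
  have hmono : ∀ i j, R i j ≤ R (i + 1) j := fun i j => le_of_forall_lt fun c hc =>
    (h _ _ _).2 ⟨((h _ _ _).1 hc).1, ((h _ _ _).1 hc).2.trans (by omega)⟩
  rw [Finset.card_eq_sum_card_fiberwise (f := Prod.fst) (t := Finset.range J)
    (fun d hd => by simpa using (Finset.mem_filter.1 hd).2.1), ← Finset.sum_add_distrib]
  refine Finset.sum_congr rfl fun j hj => ?_
  have : ((b.cells \ a.cells).filter (fun d => d.1 < J ∧ T d = m + 1)).filter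
      (fun d => d.1 = j) = (Finset.Ico (R m j) (R (m + 1) j)).image (fun c => (j, c)) := by
    ext ⟨j', c⟩
    simp only [Finset.mem_filter, mem_sdiff_iff, Finset.mem_image, Finset.mem_Ico, Prod.mk.injEq]
    have e1 := h m j c
    have e2 := h (m + 1) j c
    have e3 := h 0 j c
    rw [h0] at e3
    have hj' := Finset.mem_range.1 hj
    constructor
    · rintro ⟨⟨h1, h2, h3⟩, rfl⟩
      exact ⟨c, by omega, rfl, rfl⟩
    · rintro ⟨c', h1, rfl, rfl⟩
      refine ⟨⟨?_, ?_, ?_⟩, rfl⟩ <;> omega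
  rw [this, Finset.card_image_of_injective _ (fun c c' hc => (Prod.mk.inj hc).2), Nat.card_Ico]
  have := hmono m j
  omega

theorem IsLRTableau.lrChain {a g b : YoungDiagram} {T : ℕ × ℕ → ℕ} {R : ℕ → ℕ → ℕ}
    (hab : a ≤ b) (h : RowCount b T R) (hT : IsLRTableau a g b T) : LRChain a g b R := by
  obtain ⟨t1, t2, t3, t4, t5⟩ := hT
  have hle := le_iff_rowLen.1 hab
  have h0 : ∀ j, R 0 j = a.rowLen j := fun j => eq_of_forall_lt_iff fun c => by
    rw [h]
    have := t1 (j, c)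
    rw [mem_sdiff_iff] at this
    have := hle j
    omega
  have hcard := h.card_add h0
  have hmono : ∀ i j, R i j ≤ R (i + 1) j := fun i j => le_of_forall_lt fun c hc =>
    (h _ _ _).2 ⟨((h _ _ _).1 hc).1, ((h _ _ _).1 hc).2.trans (by omega)⟩
  have hN : ∀ m, ∀ J, ((b.cells \ a.cells).filter (fun d => d.1 < J ∧ T d = m + 2)).card ≤
      ((b.cells \ a.cells).filter (fun d => d.1 < J - 1 ∧ T d = m + 1)).card := by
    intro m J
    induction J with
    | zero => simp
    | succ j ih =>
      by_cases hj : R (m + 1) j < R (m + 2) j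
      · have e1 := (h (m + 2) j (R (m + 1) j)).1 hj
        have e2 := h (m + 1) j (R (m + 1) j)
        have e3 := h 0 j (R (m + 1) j)
        rw [h0] at e3
        have hc : (j, R (m + 1) j) ∈ b.cells \ a.cells := by
          rw [mem_sdiff_iff]; omega
        refine le_trans ?_ ((t5 _ hc m).trans ?_)
        · refine Finset.card_le_card fun d hd => ?_
          simp only [Finset.mem_filter] at hd ⊢
          refine ⟨hd.1, ?_, hd.2.2⟩
          by_cases hdj : d.1 < j
          · exact Or.inl hdj
          · have hdj' : d.1 = j := by omega
            refine Or.inr ⟨hdj', ?_⟩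
            have e4 := h (m + 1) j d.2
            obtain ⟨d1, d2⟩ := d
            simp only at hdj' e4 hd ⊢
            subst hdj'
            omega
        · refine Finset.card_le_card fun d hd => ?_
          simp only [Finset.mem_filter] at hd ⊢
          refine ⟨hd.1, ?_, hd.2.2⟩
          obtain ⟨d1, d2⟩ := d
          obtain ⟨hd1, hd2 | hd2, hd3⟩ := hd
          · simpa using hd2
          · exfalso
            simp only at hd2
            obtain ⟨rfl, hd2⟩ := hd2
            have e4 := h (m + 1) d1 d2
            rw [mem_sdiff_iff] at hd1
            omega
      · have e1 := hcard (m + 1) (j + 1)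
        have e2 := hcard (m + 1) j
        rw [Finset.sum_range_succ, Finset.sum_range_succ] at e1
        have e3 := hmono (m + 1) j
        have e4 : ((b.cells \ a.cells).filter (fun d => d.1 < j - 1 ∧ T d = m + 1)).card ≤
          ((b.cells \ a.cells).filter (fun d => d.1 < j + 1 - 1 ∧ T d = m + 1)).card := by
          refine Finset.card_le_card fun d hd => ?_
          simp only [Finset.mem_filter] at hd ⊢
          exact ⟨hd.1, by omega, hd.2.2⟩
        simp only [add_assoc, one_add_one_eq_two] at *
        omega
  refine ⟨h0, hmono, ?_, ?_, ?_, ?_⟩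
  · intro i j
    refine le_of_forall_lt fun c hc => ?_
    have e1 := (h _ _ _).1 hc
    have e2 := b.rowLen_anti j (j + 1) (by omega)
    refine (h _ _ _).2 ⟨by omega, ?_⟩
    by_cases hz : T (j, c) = 0
    · omega
    · have e3 := (t1 (j, c)).2 hz
      have e4 := a.rowLen_anti j (j + 1) (by omega)
      have e5 : (j + 1, c) ∈ b.cells \ a.cells := by
        rw [mem_sdiff_iff] at e3 ⊢; omega
      have := t3 j (j + 1) c (by omega) e3 e5
      omega
  · intro i hi j
    refine eq_of_forall_lt_iff fun c => ?_
    rw [h]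
    refine ⟨And.left, fun hc => ⟨hc, ?_⟩⟩
    by_contra hlt
    have e1 := t4 (T (j, c) - 1)
    rw [rowLen_eq_zero_iff.2 (show g.colLen 0 ≤ T (j, c) - 1 by omega),
      Finset.card_eq_zero, Finset.filter_eq_empty_iff] at e1
    exact e1 ((t1 (j, c)).2 (by omega)) (by omega)
  · refine ⟨b.colLen 0, fun J hJ i => ?_⟩
    rw [← hcard, ← t4, add_comm]
    congr 2
    refine Finset.filter_congr fun d hd => ?_
    obtain ⟨j, c⟩ := d
    rw [mem_sdiff_iff] at hd
    have : ¬ b.colLen 0 ≤ j := fun hj => by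
      rw [rowLen_eq_zero_iff.2 hj] at hd; omega
    simp only
    constructor
    · exact fun hh => hh.2
    · exact fun hh => ⟨by omega, hh⟩
  · intro i j
    have e1 := hcard (i + 1) (j + 1)
    have e2 := hcard i j
    have e3 := hN i (j + 1)
    simp only [add_assoc, one_add_one_eq_two, Nat.add_sub_cancel] at *
    omega

theorem LRChain.antitone {a g b : YoungDiagram} {R : ℕ → ℕ → ℕ} (h : LRChain a g b R) (i : ℕ) :
    Antitone (R i) := by
  refine antitone_nat_of_succ_le fun j => ?_
  cases i with
  | zero => rw [h.zero, h.zero]; exact a.rowLen_anti _ _ (by omega)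
  | succ i => exact (h.strip i j).trans (h.mono i j)

theorem LRChain.isLRTableau {a g b : YoungDiagram} {T : ℕ × ℕ → ℕ} {R : ℕ → ℕ → ℕ}
    (hc : RowCount b T R) (hz : ∀ j c, b.rowLen j ≤ c → T (j, c) = 0) (h : LRChain a g b R) :
    IsLRTableau a g b T := by
  have hcard := hc.card_add h.zero
  refine ⟨?_, ?_, ?_, ?_, ?_⟩
  · rintro ⟨j, c⟩
    rw [mem_sdiff_iff]
    have e1 := hc 0 j c
    have e2 := hz j c
    rw [h.zero] at e1
    by_cases hb : b.rowLen j ≤ c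
    · have := e2 hb; omega
    · omega
  · intro i j j' hj h1 h2
    rw [mem_sdiff_iff] at h1 h2
    have := (hc (T (i, j')) i j').2 ⟨h2.2, le_rfl⟩
    exact ((hc _ _ _).1 (lt_of_le_of_lt hj this)).2
  · intro i i' j hi h1 h2
    rw [mem_sdiff_iff] at h1 h2
    have e1 := (hc (T (i', j)) i' j).2 ⟨h2.2, le_rfl⟩
    have e2 : T (i', j) ≠ 0 := fun h0 => by
      rw [h0, h.zero] at e1; omega
    obtain ⟨m, hm⟩ := Nat.exists_eq_succ_of_ne_zero e2
    obtain ⟨k, hk⟩ : ∃ k, i' = k + 1 := ⟨i' - 1, by omega⟩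
    rw [hm] at e1 ⊢
    rw [hk, Nat.succ_eq_add_one] at e1
    have e3 := h.strip m k
    have e4 := h.antitone m (show i ≤ k by omega)
    have := ((hc m i j).1 (by omega)).2
    omega
  · intro k
    obtain ⟨J₀, hJ⟩ := h.content
    have e1 := hJ (max J₀ (b.colLen 0)) (le_max_left _ _) k
    rw [← hcard, add_comm, Nat.add_left_cancel_iff] at e1
    rw [← e1]
    congr 1
    refine Finset.filter_congr fun d hd => ?_
    obtain ⟨j, c⟩ := d
    rw [mem_sdiff_iff] at hd
    have : ¬ b.colLen 0 ≤ j := fun hj => by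
      rw [rowLen_eq_zero_iff.2 hj] at hd; omega
    simp only
    constructor
    · exact fun hh => ⟨by omega, hh⟩
    · exact fun hh => hh.2
  · rintro ⟨j, c⟩ hjc k
    have e1 := hcard (k + 1) (j + 1)
    have e2 := hcard k j
    have e3 := h.lattice k j
    have e4 : ((b.cells \ a.cells).filter (fun d => d.1 < j + 1 ∧ T d = k + 1 + 1)).card ≤
      ((b.cells \ a.cells).filter (fun d => d.1 < j ∧ T d = k + 1)).card := by
      simp only [add_assoc, one_add_one_eq_two] at *
      omega
    refine le_trans (Finset.card_le_card fun d hd => ?_) (e4.trans (Finset.card_le_card fun d hd =>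
      ?_))
    · simp only [Finset.mem_filter] at hd ⊢
      exact ⟨hd.1, by omega, hd.2.2⟩
    · simp only [Finset.mem_filter] at hd ⊢
      exact ⟨hd.1, Or.inl hd.2.1, hd.2.2⟩

theorem lrCoeff_eq_card (a g b : YoungDiagram) :
    lrCoeff a g b = Nat.card {R : ℕ → ℕ → ℕ // LRChain a g b R} := by
  rw [lrCoeff]
  split_ifs with hab
  · have key1 : ∀ T, IsLRTableau a g b T → RowCount b T
        (fun i j => ((Finset.range (b.rowLen j)).filter (fun c => T (j, c) ≤ i)).card) := by
      intro T hT i j c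
      have hinit : ∀ c c', c ≤ c' → c' < b.rowLen j → T (j, c') ≤ i → T (j, c) ≤ i := by
        intro c c' hcc hc' hi
        by_cases hz : T (j, c) = 0
        · omega
        · have h1 := (hT.1 _).2 hz
          have h2 : (j, c') ∈ b.cells \ a.cells := by
            rw [mem_sdiff_iff] at h1 ⊢; omega
          exact (hT.2.1 _ _ _ hcc h1 h2).trans hi
      constructor
      · intro hc
        simp only at hc
        by_contra hcon
        have : (Finset.range (b.rowLen j)).filter (fun c => T (j, c) ≤ i) ⊆ Finset.range c := by
          intro c' hc'
          simp only [Finset.mem_filter, Finset.mem_range] at hc' ⊢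
          by_contra hlt
          exact hcon ⟨by omega, hinit c c' (by omega) hc'.1 hc'.2⟩
        have := Finset.card_le_card this
        rw [Finset.card_range] at this
        omega
      · rintro ⟨hc, hi⟩
        simp only
        have : Finset.range (c + 1) ⊆
            (Finset.range (b.rowLen j)).filter (fun c => T (j, c) ≤ i) := by
          intro c' hc'
          simp only [Finset.mem_filter, Finset.mem_range] at hc' ⊢
          exact ⟨by omega, hinit c' c (by omega) hc hi⟩
        have := Finset.card_le_card this
        rw [Finset.card_range] at this
        omega
    have key2 : ∀ R, LRChain a g b R → RowCount b (fun d => sInf {i | d.2 < R i d.1}) R := by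
      intro R hR i j c
      have hm : ∀ i i', i ≤ i' → R i j ≤ R i' j := fun i i' hi =>
        monotone_nat_of_le_succ (f := fun i => R i j) (fun i => hR.mono i j) hi
      constructor
      · intro hc
        exact ⟨lt_of_lt_of_le hc (hR.le_top i j), Nat.sInf_le hc⟩
      · rintro ⟨hc, hi⟩
        have : sInf {i | c < R i j} ∈ {i | c < R i j} :=
          Nat.sInf_mem ⟨g.colLen 0, by simpa [hR.top _ le_rfl] using hc⟩
        exact lt_of_lt_of_le this (hm _ _ hi)
    have key3 : ∀ R, LRChain a g b R → ∀ j c, b.rowLen j ≤ c → sInf {i | c < R i j} = 0 := by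
      intro R hR j c hc
      have : {i | c < R i j} = ∅ := by
        ext i
        have := hR.le_top i j
        simp only [Set.mem_ofPred_eq, Set.mem_empty_iff_false, iff_false]
        omega
      rw [this, Nat.sInf_empty]
    refine Nat.card_congr ⟨fun T => ⟨_, T.2.lrChain hab (key1 T.1 T.2)⟩,
      fun R => ⟨_, R.2.isLRTableau (key2 R.1 R.2) (key3 R.1 R.2)⟩, ?_, ?_⟩
    · rintro ⟨T, hT⟩
      ext ⟨j, c⟩
      simp only
      have hR := hT.lrChain hab (key1 T hT)
      have h1 := key1 T hT
      have h2 := key2 _ hR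
      by_cases hc : c < b.rowLen j
      · refine eq_of_forall_ge_iff fun i => ?_
        have e1 := h1 i j c
        have e2 := h2 i j c
        simp only at e2
        tauto
      · rw [key3 _ hR j c (by omega)]
        by_contra hz
        have := (hT.1 (j, c)).2 (Ne.symm hz)
        rw [mem_sdiff_iff] at this
        omega
    · rintro ⟨R, hR⟩
      ext i j
      simp only
      have h1 := key1 _ (hR.isLRTableau (key2 R hR) (key3 R hR))
      have h2 := key2 R hR
      refine eq_of_forall_lt_iff fun c => ?_
      rw [h2 i j c, ← h1 i j c]
  · have : IsEmpty {R : ℕ → ℕ → ℕ // LRChain a g b R} := ⟨fun R => hab R.2.le⟩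
    rw [Nat.card_of_isEmpty]

end LRTableaux

section LRPieri

/-- The diagrams obtained from `a` by adding one box. -/
def ups (a : YoungDiagram) : Finset YoungDiagram := (level (a.card + 1)).filter (Cov a)

/-- The diagrams obtained from `b` by removing one box. -/
def downs (b : YoungDiagram) : Finset YoungDiagram := (below b).filter (fun a => Cov a b)

@[simp] theorem mem_ups {a b : YoungDiagram} : b ∈ ups a ↔ Cov a b := by
  simpa [ups] using fun h : Cov a b => h.2

@[simp] theorem mem_downs {a b : YoungDiagram} : a ∈ downs b ↔ Cov a b := by
  simpa [downs] using fun h : Cov a b => h.1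

theorem finite_lrChain (a g b : YoungDiagram) : {R | LRChain a g b R}.Finite := by
  refine Set.Finite.of_finite_image (f := fun R (p : Fin (g.colLen 0) × Fin (b.colLen 0)) =>
    min (R p.1 p.2) (b.rowLen 0)) ?_ ?_
  · refine (Set.Finite.pi' (fun _ => Set.finite_Iic (b.rowLen 0))).subset ?_
    rintro _ ⟨R, -, rfl⟩ p
    exact Set.mem_Iic.2 (min_le_right _ _)
  · intro R hR R' hR' h
    have hle : ∀ S, LRChain a g b S → ∀ i j, S i j ≤ b.rowLen 0 := fun S hS i j =>
      (hS.le_top i j).trans (b.rowLen_anti _ _ (by omega))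
    funext i j
    by_cases hi : g.colLen 0 ≤ i
    · rw [hR.top i hi, hR'.top i hi]
    by_cases hj : b.colLen 0 ≤ j
    · have h1 := hR.le_top i j
      have h2 := hR'.le_top i j
      have h3 := rowLen_eq_zero_iff.2 hj
      omega
    have := congrFun h (⟨i, by omega⟩, ⟨j, by omega⟩)
    simpa [hle R hR, hle R' hR'] using this

/-- The finite set of Littlewood–Richardson chains. -/
def lrChains (a g b : YoungDiagram) : Finset (ℕ → ℕ → ℕ) := (finite_lrChain a g b).toFinset

@[simp] theorem mem_lrChains {a g b : YoungDiagram} {R : ℕ → ℕ → ℕ} :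
    R ∈ lrChains a g b ↔ LRChain a g b R := by simp [lrChains]

theorem lrCoeff_eq_card_lrChains (a g b : YoungDiagram) :
    lrCoeff a g b = (lrChains a g b).card := by
  rw [lrCoeff_eq_card]
  exact Set.ncard_eq_toFinset_card _ (finite_lrChain a g b)

theorem sum_ups_lrCoeff (a g b : YoungDiagram) :
    ∑ a' ∈ ups a, lrCoeff a' g b = ∑ b' ∈ downs b, lrCoeff a g b' := by
  simp only [lrCoeff_eq_card_lrChains]
  rw [← Finset.card_biUnion, ← Finset.card_biUnion]
  · have f1 : ∀ R ∈ (ups a).biUnion fun a' => lrChains a' g b,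
        ∃ R' r, Slide R R' r ∧ R' ∈ (downs b).biUnion fun b' => lrChains a g b' := by
      intro R hR
      simp only [Finset.mem_biUnion, mem_ups, mem_lrChains] at hR
      obtain ⟨a', ha, hR⟩ := hR
      obtain ⟨R', r, b', h1, h2, h3⟩ := hR.exists_slide ha
      exact ⟨R', r, h1, by simpa using ⟨b', h2, h3⟩⟩
    have f2 : ∀ R' ∈ (downs b).biUnion fun b' => lrChains a g b',
        ∃ R r, Slide R R' r ∧ R ∈ (ups a).biUnion fun a' => lrChains a' g b := by
      intro R hR
      simp only [Finset.mem_biUnion, mem_downs, mem_lrChains] at hR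
      obtain ⟨b', hb, hR⟩ := hR
      obtain ⟨R', r, a', h1, h2, h3⟩ := hR.exists_unslide hb
      exact ⟨R', r, h1, by simpa using ⟨a', h2, h3⟩⟩
    choose! F r hF hF' using f1
    choose! G s hG hG' using f2
    apply le_antisymm
    · refine Finset.card_le_card_of_injOn F (fun R hR => hF' R hR) ?_
      intro R₁ h₁ R₂ h₂ h12
      have s1 := hF R₁ h₁
      have s2 := hF R₂ h₂
      rw [← h12] at s2
      simp only [Finset.coe_biUnion, Set.mem_iUnion, Finset.mem_coe, mem_ups, mem_lrChains,
        exists_prop] at h₁ h₂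
      obtain ⟨a₁, ha₁, h₁⟩ := h₁
      obtain ⟨a₂, ha₂, h₂⟩ := h₂
      exact Slide.unique_symm s1 s2 h₁.strip h₂.strip
        (fun i hi j => by rw [h₁.top i hi, h₂.top i hi])
    · refine Finset.card_le_card_of_injOn G (fun R hR => hG' R hR) ?_
      intro R₁ h₁ R₂ h₂ h12
      have s1 := hG R₁ h₁
      have s2 := hG R₂ h₂
      rw [← h12] at s2
      simp only [Finset.coe_biUnion, Set.mem_iUnion, Finset.mem_coe, mem_downs, mem_lrChains,
        exists_prop] at h₁ h₂
      obtain ⟨a₁, ha₁, h₁⟩ := h₁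
      obtain ⟨a₂, ha₂, h₂⟩ := h₂
      exact Slide.unique s1 s2 (fun j => by rw [h₁.zero, h₂.zero])
  · intro b₁ _ b₂ _ hne
    refine Finset.disjoint_left.2 fun R h1 h2 => hne (ext_rowLen fun j => ?_)
    rw [mem_lrChains] at h1 h2
    rw [← h1.top _ le_rfl, ← h2.top _ le_rfl]
  · intro a₁ _ a₂ _ hne
    refine Finset.disjoint_left.2 fun R h1 h2 => hne (ext_rowLen fun j => ?_)
    rw [mem_lrChains] at h1 h2
    rw [← h1.zero, ← h2.zero]

theorem LRChain.card {a g b : YoungDiagram} {R : ℕ → ℕ → ℕ} (h : LRChain a g b R) :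
    b.card = a.card + g.card := by
  obtain ⟨J₀, hJ⟩ := h.content
  have key : ∀ J, J₀ ≤ J → ∀ i, ∑ j ∈ Finset.range J, R i j =
      ∑ j ∈ Finset.range J, R 0 j + ∑ k ∈ Finset.range i, g.rowLen k := by
    intro J hJ' i
    induction i with
    | zero => simp
    | succ i ih => rw [hJ J hJ', ih, Finset.sum_range_succ, add_assoc]
  have h1 := key (J₀ + b.colLen 0 + a.colLen 0) (by omega) (g.colLen 0)
  simp only [h.top _ le_rfl, h.zero] at h1
  rw [card_eq_sum_rowLen b (N := J₀ + b.colLen 0 + a.colLen 0) (rowLen_eq_zero_iff.2 (by omega)),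
    card_eq_sum_rowLen a (N := J₀ + b.colLen 0 + a.colLen 0) (rowLen_eq_zero_iff.2 (by omega)),
    card_eq_sum_rowLen g (exists_rowLen_eq_zero g), h1]

/-- Entries `i + 1` of a Littlewood–Richardson tableau do not occur in rows above row `i`. -/
theorem LRChain.eq_of_lt {a g b : YoungDiagram} {R : ℕ → ℕ → ℕ} (h : LRChain a g b R) (i j : ℕ)
    (hj : j < i) : R (i + 1) j = R i j := by
  induction i generalizing j with
  | zero => omega
  | succ i ih =>
    have h1 := h.lattice i j
    have h2 : ∑ j' ∈ Finset.range j, R (i + 1) j' = ∑ j' ∈ Finset.range j, R i j' :=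
      Finset.sum_congr rfl fun j' hj' => ih j' (by have := Finset.mem_range.1 hj'; omega)
    have h3 : ∑ j' ∈ Finset.range j, R (i + 1) j' ≤ ∑ j' ∈ Finset.range j, R (i + 2) j' :=
      Finset.sum_le_sum fun j' _ => h.mono (i + 1) j'
    have h4 := h.mono (i + 1) j
    rw [Finset.sum_range_succ, Finset.sum_range_succ] at h1
    rw [add_assoc, one_add_one_eq_two] at h4 ⊢
    omega

theorem LRChain.content_le {a g b : YoungDiagram} {R : ℕ → ℕ → ℕ} (h : LRChain a g b R) :
    g ≤ b := by
  refine le_iff_rowLen.2 fun i => ?_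
  obtain ⟨J₀, hJ⟩ := h.content
  have key : ∀ n, ∑ j ∈ Finset.range (i + n + 1), R (i + 1) j + R i (i + n) ≤
      ∑ j ∈ Finset.range (i + n + 1), R i j + R (i + 1) i := by
    intro n
    induction n with
    | zero =>
      simp only [add_zero]
      have : ∑ j ∈ Finset.range i, R (i + 1) j = ∑ j ∈ Finset.range i, R i j :=
        Finset.sum_congr rfl fun j hj => h.eq_of_lt i j (Finset.mem_range.1 hj)
      rw [Finset.sum_range_succ, Finset.sum_range_succ]
      omega
    | succ n ih =>
      have := h.strip i (i + n)
      rw [← add_assoc, Finset.sum_range_succ, Finset.sum_range_succ _ (i + n + 1)]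
      omega
  have h1 := key J₀
  have h2 := hJ (i + J₀ + 1) (by omega) i
  have h3 := h.le_top (i + 1) i
  omega

end LRPieri

section LRRect

theorem rowLen_rect (r c j : ℕ) : (rect r c).rowLen j = if j < r then c else 0 := by
  refine eq_of_forall_lt_iff fun k => ?_
  rw [← YoungDiagram.mem_iff_lt_rowLen, mem_rect]
  split_ifs <;> simp_all

/-- The only possible Littlewood–Richardson chain with top shape a rectangle. -/
def rectChain (a : YoungDiagram) (r c i j : ℕ) : ℕ :=
  if r ≤ j then 0 else if j < i then c else a.rowLen (j - i)

theorem LRChain.eq_rectChain {a g : YoungDiagram} {r c : ℕ} {R : ℕ → ℕ → ℕ}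
    (h : LRChain a g (rect r c) R) :
    R = rectChain a r c ∧ ∀ i < r, g.rowLen i + a.rowLen (r - 1 - i) = c := by
  have h0 : ∀ i j, r ≤ j → R i j = 0 := fun i j hj => by
    have := h.le_top i j
    rw [rowLen_rect, if_neg (by omega)] at this
    omega
  have hle : ∀ i j, R i j ≤ c := fun i j => by
    have := h.le_top i j
    rw [rowLen_rect] at this
    split_ifs at this <;> omega
  have hc : ∀ i j, j < i → j < r → R i j = c := fun i j hj hr => by
    have : ∀ n, R (i + n) j = R i j := fun n => by
      induction n with
      | zero => rfl
      | succ n ih => rw [← ih, ← add_assoc, h.eq_of_lt (i + n) j (by omega)]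
    rw [← this (g.colLen 0), h.top _ (by omega), rowLen_rect, if_pos hr]
  have hS : ∀ i j, j ≤ i → j ≤ r → ∑ j' ∈ Finset.range j, R i j' = j * c := fun i j hj hr => by
    rw [Finset.sum_congr rfl fun j' hj' => hc i j' (by have := Finset.mem_range.1 hj'; omega)
      (by have := Finset.mem_range.1 hj'; omega)]
    simp
  have hU1 : ∀ j, j + 1 ≤ r → ∀ n i, j ≤ i + n →
      ∑ j' ∈ Finset.range j, R i j' + c ≤ ∑ j' ∈ Finset.range (j + 1), R (i + 1) j' := by
    intro j hj n
    induction n with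
    | zero =>
      intro i hi
      rw [hS i j hi (by omega), hS (i + 1) (j + 1) (by omega) hj, add_one_mul]
    | succ n ih =>
      intro i hi
      have h1 := ih (i + 1) (by omega)
      have h2 := h.lattice i j
      rw [add_assoc i, one_add_one_eq_two] at h1
      omega
  have hU2 : ∀ i j, ∑ j' ∈ Finset.range (j + 1), R (i + 1) j' ≤
      ∑ j' ∈ Finset.range j, R i j' + c := by
    intro i j
    rw [Finset.sum_range_succ']
    exact add_le_add (Finset.sum_le_sum fun j' _ => h.strip i j') (hle _ _)
  have hU : ∀ i j, j + 1 ≤ r → ∑ j' ∈ Finset.range (j + 1), R (i + 1) j' =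
      ∑ j' ∈ Finset.range j, R i j' + c := fun i j hj =>
    le_antisymm (hU2 i j) (hU1 j hj j i (by omega))
  have hshift : ∀ i j, j + 1 < r → R (i + 1) (j + 1) = R i j := by
    intro i j hj
    have h1 := hU i j (by omega)
    have h2 := hU i (j + 1) (by omega)
    rw [Finset.sum_range_succ, h1, Finset.sum_range_succ _ j] at h2
    omega
  have hdiag : ∀ i k, i + k < r → R i (k + i) = a.rowLen k := by
    intro i
    induction i with
    | zero => intro k _; exact h.zero k
    | succ i ih =>
      intro k hk
      rw [← add_assoc, hshift i (k + i) (by omega), ih k (by omega)]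
  refine ⟨?_, ?_⟩
  · funext i j
    rw [rectChain]
    split_ifs with h1 h2
    · exact h0 i j h1
    · exact hc i j h2 (by omega)
    · have := hdiag i (j - i) (by omega)
      rwa [Nat.sub_add_cancel (by omega)] at this
  · intro i hi
    obtain ⟨J₀, hJ⟩ := h.content
    have hst : ∀ i n, ∑ j ∈ Finset.range (r + n), R i j = ∑ j ∈ Finset.range r, R i j := by
      intro i n
      rw [Finset.sum_range_add, Finset.sum_eq_zero (s := Finset.range n), add_zero]
      exact fun j _ => h0 _ _ (by omega)
    have h1 := hJ (r + J₀) (by omega) i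
    rw [hst, hst] at h1
    obtain ⟨m, rfl⟩ : ∃ m, r = m + 1 := ⟨r - 1, by omega⟩
    rw [hU i m le_rfl, Finset.sum_range_succ] at h1
    have h2 := hdiag i (m - i) (by omega)
    rw [Nat.sub_add_cancel (by omega)] at h2
    rw [Nat.add_sub_cancel]
    omega

theorem lrChain_rectChain {a g : YoungDiagram} {r c : ℕ} (ha : a ≤ rect r c) (hg : g ≤ rect r c)
    (h : ∀ i < r, g.rowLen i + a.rowLen (r - 1 - i) = c) :
    LRChain a g (rect r c) (rectChain a r c) := by
  have ha0 : ∀ j, r ≤ j → a.rowLen j = 0 := fun j hj =>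
    Nat.le_zero.1 ((le_rect_iff.1 ha).1 ▸ a.rowLen_anti _ _ hj)
  have hg0 : ∀ j, r ≤ j → g.rowLen j = 0 := fun j hj =>
    Nat.le_zero.1 ((le_rect_iff.1 hg).1 ▸ g.rowLen_anti _ _ hj)
  have hac : ∀ j, a.rowLen j ≤ c := fun j =>
    (le_iff_rowLen.1 ha j).trans (by rw [rowLen_rect]; split_ifs <;> omega)
  have hmono : ∀ i j, rectChain a r c i j ≤ rectChain a r c (i + 1) j := by
    intro i j
    have h1 := hac (j - i)
    have h2 := a.rowLen_anti (j - (i + 1)) (j - i) (by omega)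
    unfold rectChain
    split_ifs <;> omega
  have hshift : ∀ i j, j + 1 < r → rectChain a r c (i + 1) (j + 1) = rectChain a r c i j := by
    intro i j hj
    unfold rectChain
    rw [show j + 1 - (i + 1) = j - i by omega]
    split_ifs <;> omega
  have hzero : ∀ i j, r ≤ j → rectChain a r c i j = 0 := fun i j hj => if_pos hj
  have hfirst : ∀ i, 0 < r → rectChain a r c (i + 1) 0 = c := fun i hr => by
    simp [rectChain, hr.ne']
  refine ⟨?_, hmono, ?_, ?_, ⟨r, ?_⟩, ?_⟩
  · intro j
    unfold rectChain
    split_ifs with h1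
    · exact (ha0 j h1).symm
    · omega
    · rfl
  · intro i j
    by_cases hj : j + 1 < r
    · exact (hshift i j hj).le
    · rw [hzero _ _ (by omega)]; omega
  · intro i hi j
    rw [rowLen_rect]
    unfold rectChain
    split_ifs with h1 h2 h3 h3 h4
    · omega
    · rfl
    · rfl
    · omega
    · have h5 := h i (by omega)
      rw [rowLen_eq_zero_iff.2 hi] at h5
      have h6 := a.rowLen_anti (j - i) (r - 1 - i) (by omega)
      have h7 := hac (j - i)
      omega
    · omega
  · intro J hJ i
    obtain ⟨n, rfl⟩ := Nat.exists_eq_add_of_le hJ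
    rw [Finset.sum_range_add, Finset.sum_range_add,
      Finset.sum_eq_zero fun j _ => hzero (i + 1) (r + j) (by omega),
      Finset.sum_eq_zero fun j _ => hzero i (r + j) (by omega)]
    cases r with
    | zero => simp [hg0 i]
    | succ m =>
      rw [Finset.sum_range_succ', hfirst i (by omega), Finset.sum_range_succ]
      have h1 := h i
      have h2 := hg0 i
      have : rectChain a (m + 1) c i m + g.rowLen i = c := by
        unfold rectChain
        split_ifs with h3 h4
        · omega
        · have := h2 (by omega)
          omega
        · have := h1 (by omega)
          rw [Nat.add_sub_cancel] at this
          omega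
      have hS : ∑ j ∈ Finset.range m, rectChain a (m + 1) c (i + 1) (j + 1) =
          ∑ j ∈ Finset.range m, rectChain a (m + 1) c i j :=
        Finset.sum_congr rfl fun j hj => hshift i j (by have := Finset.mem_range.1 hj; omega)
      omega
  · intro i j
    induction j with
    | zero =>
      by_cases hr : 0 < r
      · simp [hfirst _ hr]
      · simp [hzero _ 0 (by omega)]
    | succ j ih =>
      have : rectChain a r c (i + 2) (j + 1) + rectChain a r c i j ≤
          rectChain a r c (i + 1) j + rectChain a r c (i + 1) (j + 1) := by
        by_cases hj : j + 1 < r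
        · rw [hshift i j hj, hshift (i + 1) j hj]
        · have := hmono i j
          rw [hzero (i + 2) (j + 1) (by omega)]
          omega
      have e1 := Finset.sum_range_succ (rectChain a r c (i + 2)) (j + 1)
      have e2 := Finset.sum_range_succ (rectChain a r c (i + 1)) (j + 1)
      have e3 := Finset.sum_range_succ (rectChain a r c (i + 1)) j
      have e4 := Finset.sum_range_succ (rectChain a r c i) j
      omega

theorem lrCoeff_rect {a g : YoungDiagram} {r c : ℕ} (ha : a ≤ rect r c) (hg : g ≤ rect r c) :
    lrCoeff a g (rect r c) =
      if ∀ i < r, g.rowLen i + a.rowLen (r - 1 - i) = c then 1 else 0 := by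
  rw [lrCoeff_eq_card_lrChains]
  split_ifs with h
  · refine Finset.card_eq_one.2 ⟨rectChain a r c, ?_⟩
    ext R
    rw [mem_lrChains, Finset.mem_singleton]
    exact ⟨fun hR => hR.eq_rectChain.1, fun hR => hR ▸ lrChain_rectChain ha hg h⟩
  · refine Finset.card_eq_zero.2 (Finset.eq_empty_of_forall_notMem fun R hR => h ?_)
    exact (mem_lrChains.1 hR).eq_rectChain.2

end LRRect

section Moments

open Polynomial in
theorem sum_eval_add_one_div (m : ℕ) (v : ℕ → ℚ) (hv : Set.InjOn v (Finset.range (m + 3)))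
    (hv0 : v (m + 2) = 0) (w : ℕ → ℚ) (hw : ∀ k, w k =
      (∏ j ∈ Finset.range (m + 2), (v k + 1 - v j)) /
        ∏ j ∈ (Finset.range (m + 3)).erase k, (v k - v j)) :
    ∑ k ∈ Finset.range (m + 3), w k = 1 ∧
    ∑ k ∈ Finset.range (m + 3), v k * w k = m + 2 ∧
    ∑ k ∈ Finset.range (m + 3), v k ^ 2 * w k =
      (m + 2) * (m + 1) / 2 + ∑ k ∈ Finset.range (m + 3), v k := by
  set R : ℚ[X] := ∏ j ∈ Finset.range (m + 2), (X - C (v j)) with hR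
  have hmon : R.Monic := monic_prod_of_monic _ _ fun j _ => monic_X_sub_C (v j)
  have hdeg : R.natDegree = m + 2 := by
    rw [hR, natDegree_prod_of_monic _ _ fun j _ => monic_X_sub_C (v j)]
    simp
  have hnext : R.coeff (m + 1) = -∑ k ∈ Finset.range (m + 3), v k := by
    rw [Finset.sum_range_succ, hv0, add_zero, ← prod_X_sub_C_nextCoeff,
      nextCoeff_of_natDegree_pos (by rw [← hR, hdeg]; omega), ← hR, hdeg]
    rfl
  have htop : R.coeff (m + 2) = 1 := by
    rw [← hdeg]; exact hmon
  have hevR : ∀ z, R.eval z = ∏ j ∈ Finset.range (m + 2), (z - v j) := fun z => by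
    rw [hR, eval_prod]; simp
  have hroot : ∀ k ∈ Finset.range (m + 3), v k * R.eval (v k) = 0 := fun k hk => by
    by_cases h : k = m + 2
    · rw [h, hv0, zero_mul]
    · rw [hevR, Finset.prod_eq_zero (i := k) (by have := Finset.mem_range.1 hk; simp; omega)
        (sub_self _), mul_zero]
  set T := taylor 1 R with hT
  have hevT : ∀ z, T.eval z = R.eval (z + 1) := fun z => by rw [hT, taylor_eval]
  have hTdeg : T.natDegree = m + 2 := by rw [hT, natDegree_taylor, hdeg]
  have hT2 : T.coeff (m + 2) = 1 := by
    have : (taylor 1 R).Monic := by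
      rw [Monic, leadingCoeff, natDegree_taylor, coeff_taylor_natDegree]
      exact hmon
    rw [← hTdeg]; exact this
  have hTc : ∀ k d, k + d = m + 2 → T.coeff k =
      ∑ i ∈ Finset.range (d + 1), ((i + k).choose k : ℚ) * R.coeff (i + k) := fun k d hd => by
    rw [hT, taylor_coeff, eval_eq_sum_range' (n := d + 1)]
    · simp [hasseDeriv_coeff]
    · have := natDegree_hasseDeriv_le R k
      omega
  have hT1 : T.coeff (m + 1) = R.coeff (m + 1) + (m + 2) := by
    rw [hTc (m + 1) 1 (by omega)]
    simp only [Finset.sum_range_succ, Finset.sum_range_zero]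
    rw [show 1 + (m + 1) = m + 2 by omega, htop, Nat.choose_succ_self_right]
    simp
    ring
  have hT0 : T.coeff m = R.coeff m + (m + 1) * R.coeff (m + 1) + (m + 2) * (m + 1) / 2 := by
    rw [hTc m 2 (by omega)]
    simp only [Finset.sum_range_succ, Finset.sum_range_zero]
    rw [show 1 + m = m + 1 by omega, show 2 + m = m + 2 by omega, htop,
      Nat.choose_succ_self_right, Nat.choose_symm_add, Nat.cast_choose_two]
    simp only [zero_add, Nat.choose_self]
    push_cast
    ring
  have hRz : ∀ k, m + 3 ≤ k → R.coeff k = 0 := fun k hk =>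
    coeff_eq_zero_of_natDegree_lt (by omega)
  have hTz : ∀ k, m + 3 ≤ k → T.coeff k = 0 := fun k hk =>
    coeff_eq_zero_of_natDegree_lt (by omega)
  have hDz : ∀ k, m + 2 ≤ k → (T - R).coeff k = 0 := fun k hk => by
    rcases hk.eq_or_lt with rfl | hk
    · rw [coeff_sub, hT2, htop, sub_self]
    · rw [coeff_sub, hTz k hk, hRz k hk, sub_self]
  have key : ∀ Q : ℚ[X], (∀ k, m + 3 ≤ k → Q.coeff k = 0) → ∀ F : ℕ → ℚ,
      (∀ k ∈ Finset.range (m + 3), Q.eval (v k) = F k * R.eval (v k + 1)) →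
      ∑ k ∈ Finset.range (m + 3), F k * w k = Q.coeff (m + 2) := by
    intro Q hQ F hF
    have h1 := Lagrange.coeff_eq_sum hv (P := Q) (by
      rw [Finset.card_range]; exact (degree_lt_iff_coeff_zero Q _).2 hQ)
    rw [Finset.card_range] at h1
    rw [show m + 2 = m + 3 - 1 by omega, h1]
    refine Finset.sum_congr rfl fun k hk => ?_
    rw [hw, hF k hk, hevR, mul_div_assoc]
  refine ⟨?_, ?_, ?_⟩
  · have := key T hTz (fun _ => 1) (fun k _ => by rw [hevT, one_mul])
    rw [hT2] at this
    simpa using this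
  · rw [key (X * (T - R)) ?_ v ?_, coeff_X_mul, coeff_sub, hT1]
    · ring
    · intro k hk
      obtain ⟨j, rfl⟩ : ∃ j, k = j + 1 := ⟨k - 1, by omega⟩
      rw [coeff_X_mul, hDz j (by omega)]
    · intro k hk
      have := hroot k hk
      simp only [eval_mul, eval_X, eval_sub, hevT]
      linear_combination -this
  · rw [key (X * (X * (T - R)) - C ((m : ℚ) + 2) * (X * R)) ?_ (fun k => v k ^ 2) ?_, coeff_sub,
      coeff_C_mul, coeff_X_mul, coeff_X_mul, coeff_X_mul, coeff_sub, hT0, hnext]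
    · ring
    · intro k hk
      obtain ⟨j, rfl⟩ : ∃ j, k = j + 2 := ⟨k - 2, by omega⟩
      rw [coeff_sub, coeff_C_mul, coeff_X_mul, coeff_X_mul, coeff_X_mul]
      rcases (show m + 1 ≤ j by omega).eq_or_lt with rfl | hj
      · rw [coeff_sub, hT1, htop]; ring
      · rw [hDz j (by omega), hRz (j + 1) (by omega)]; ring
    · intro k hk
      have := hroot k hk
      simp only [eval_mul, eval_X, eval_sub, hevT, eval_C]
      linear_combination (-(v k) - (m + 2)) * this

end Moments

section Hooks

/-- The strictly decreasing sequence `ν_i + n - 1 - i` associated with a diagram. -/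
def beta (nu : YoungDiagram) (n i : ℕ) : ℕ := nu.rowLen i + (n - 1 - i)

theorem beta_lt {nu : YoungDiagram} {n i j : ℕ} (hij : i < j) (hj : j < n) :
    beta nu n j < beta nu n i := by
  have := nu.rowLen_anti i j hij.le
  unfold beta
  omega

theorem prod_hook_row (nu : YoungDiagram) {n i : ℕ} (hn : nu.rowLen n = 0) (hi : i < n) :
    (∏ c ∈ Finset.range (nu.rowLen i), (nu.rowLen i + nu.colLen c - i - c - 1)) *
      ∏ j ∈ Finset.Ioo i n, (beta nu n i - beta nu n j) = (beta nu n i).factorial := by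
  have hmem : ∀ j c, c < nu.rowLen j ↔ j < nu.colLen c := fun j c => by
    rw [← YoungDiagram.mem_iff_lt_rowLen, YoungDiagram.mem_iff_lt_colLen]
  have hcol : ∀ c, nu.colLen c ≤ n := fun c => (nu.colLen_anti 0 c (by omega)).trans
    (rowLen_eq_zero_iff.1 hn)
  have hinj1 : Set.InjOn (fun c => nu.rowLen i + nu.colLen c - i - c - 1)
      (Finset.range (nu.rowLen i)) := by
    intro c hc c' hc' h
    rw [Finset.mem_coe, Finset.mem_range] at hc hc'
    have h1 := (hmem i c).1 hc
    have h2 := (hmem i c').1 hc'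
    simp only at h
    by_contra hne
    rcases lt_or_gt_of_ne hne with hlt | hlt
    · have := nu.colLen_anti c c' hlt.le
      omega
    · have := nu.colLen_anti c' c hlt.le
      omega
  have hinj2 : Set.InjOn (fun j => beta nu n i - beta nu n j) (Finset.Ioo i n) := by
    intro j hj j' hj' h
    rw [Finset.mem_coe, Finset.mem_Ioo] at hj hj'
    have h1 := beta_lt (nu := nu) hj.1 hj.2
    have h2 := beta_lt (nu := nu) hj'.1 hj'.2
    simp only at h
    by_contra hne
    rcases lt_or_gt_of_ne hne with hlt | hlt
    · have := beta_lt (nu := nu) hlt hj'.2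
      omega
    · have := beta_lt (nu := nu) hlt hj.2
      omega
  have hdisj : Disjoint ((Finset.range (nu.rowLen i)).image
      (fun c => nu.rowLen i + nu.colLen c - i - c - 1))
      ((Finset.Ioo i n).image (fun j => beta nu n i - beta nu n j)) := by
    refine Finset.disjoint_left.2 fun x h1 h2 => ?_
    rw [Finset.mem_image] at h1 h2
    obtain ⟨c, hc, rfl⟩ := h1
    obtain ⟨j, hj, h⟩ := h2
    rw [Finset.mem_range] at hc
    rw [Finset.mem_Ioo] at hj
    have h1 := hmem i c
    have h2 := hmem j c
    have h3 := beta_lt (nu := nu) hj.1 hj.2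
    unfold beta at h h3
    omega
  rw [← Finset.prod_image (f := fun x => x) hinj1, ← Finset.prod_image (f := fun x => x) hinj2,
    ← Finset.prod_union, ← Finset.prod_range_add_one_eq_factorial,
    ← Finset.prod_image (s := Finset.range (beta nu n i)) (f := fun x => x)
      (fun a _ b _ h => Nat.succ_injective h)]
  · refine Finset.prod_congr (Finset.eq_of_subset_of_card_le ?_ ?_) fun _ _ => rfl
    · intro x hx
      rw [Finset.mem_union, Finset.mem_image, Finset.mem_image] at hx
      suffices x ≠ 0 ∧ x ≤ beta nu n i from
        Finset.mem_image.2 ⟨x - 1, Finset.mem_range.2 (by omega), by omega⟩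
      rcases hx with ⟨c, hc, rfl⟩ | ⟨j, hj, rfl⟩
      · rw [Finset.mem_range] at hc
        have h1 := (hmem i c).1 hc
        have h2 := hcol c
        unfold beta
        omega
      · rw [Finset.mem_Ioo] at hj
        have := beta_lt (nu := nu) hj.1 hj.2
        omega
    · rw [Finset.card_union_of_disjoint, Finset.card_image_of_injOn hinj1,
        Finset.card_image_of_injOn hinj2, 
        Finset.card_image_of_injective _ Nat.succ_injective, Finset.card_range, Finset.card_range,
        Nat.card_Ioo]
      · unfold beta; omega
      · exact hdisj
  · exact hdisj

theorem prod_cells {M : Type*} [CommMonoid M] (nu : YoungDiagram) {n : ℕ} (hn : nu.rowLen n = 0)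
    (F : ℕ × ℕ → M) : ∏ c ∈ nu.cells, F c =
      ∏ i ∈ Finset.range n, ∏ j ∈ Finset.range (nu.rowLen i), F (i, j) := by
  refine Finset.prod_finset_product _ _ _ ?_
  rintro ⟨i, j⟩
  rw [YoungDiagram.mem_cells, YoungDiagram.mem_iff_lt_rowLen]
  simp only [Finset.mem_range]
  refine ⟨fun h => ⟨?_, h⟩, And.right⟩
  by_contra hi
  have := nu.rowLen_anti n i (by omega)
  omega

theorem hookProd_mul (nu : YoungDiagram) {n : ℕ} (hn : nu.rowLen n = 0) :
    hookProd nu * ∏ i ∈ Finset.range n, ∏ j ∈ Finset.Ioo i n,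
      ((beta nu n i : ℚ) - beta nu n j) = ∏ i ∈ Finset.range n, ((beta nu n i).factorial : ℚ) := by
  rw [hookProd, prod_cells nu hn, ← Finset.prod_mul_distrib]
  refine Finset.prod_congr rfl fun i hi => ?_
  rw [← prod_hook_row nu hn (Finset.mem_range.1 hi)]
  push_cast
  congr 1
  refine Finset.prod_congr rfl fun j hj => ?_
  rw [Finset.mem_Ioo] at hj
  rw [Nat.cast_sub (beta_lt hj.1 hj.2).le]

theorem hookProd_ne_zero (nu : YoungDiagram) : hookProd nu ≠ 0 := by
  intro h
  have := hookProd_mul nu (exists_rowLen_eq_zero nu)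
  rw [h, zero_mul, eq_comm, Finset.prod_eq_zero_iff] at this
  obtain ⟨i, -, hi⟩ := this
  exact (Nat.factorial_ne_zero _) (by exact_mod_cast hi)

/-- The effect on a product of differences of raising one entry by one. -/
theorem prod_sub_update (n k : ℕ) (hk : k < n) (l l' : ℕ → ℚ)
    (hl : ∀ i, l' i = l i + if i = k then 1 else 0) (hne : ∀ j < n, j ≠ k → l k ≠ l j) :
    ∏ i ∈ Finset.range n, ∏ j ∈ Finset.Ioo i n, (l' i - l' j) =
      (∏ i ∈ Finset.range n, ∏ j ∈ Finset.Ioo i n, (l i - l j)) *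
        ∏ j ∈ (Finset.range n).erase k, ((l k + 1 - l j) / (l k - l j)) := by
  set ρ : ℕ → ℚ := fun j => (l k + 1 - l j) / (l k - l j)
  have h1 : ∀ i ∈ Finset.range n, ∏ j ∈ Finset.Ioo i n, (l' i - l' j) =
      (∏ j ∈ Finset.Ioo i n, (l i - l j)) * ((if i = k then ∏ j ∈ Finset.Ioo k n, ρ j else 1) *
        if i < k then ρ i else 1) := by
    intro i hi
    have h2 : ∀ j ∈ Finset.Ioo i n, l' i - l' j =
        (l i - l j) * ((if i = k then ρ j else 1) * if j = k then ρ i else 1) := by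
      intro j hj
      rw [Finset.mem_Ioo] at hj
      rw [hl, hl]
      split_ifs with h3 h4 h4
      · omega
      · have := sub_ne_zero.2 (hne j hj.2 h4)
        subst h3
        simp only [ρ]
        field_simp
        ring
      · have := sub_ne_zero.2 (hne i (by omega) h3)
        have h5 : l i - l k ≠ 0 := fun h => this (by linarith)
        subst h4
        simp only [ρ]
        field_simp
        ring
      · ring
    rw [Finset.prod_congr rfl h2, Finset.prod_mul_distrib, Finset.prod_mul_distrib,
      Finset.prod_ite_eq']
    congr 2
    · split_ifs with h3
      · rw [h3]
      · simp
    · simp only [Finset.mem_Ioo, hk, and_true]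
  rw [Finset.prod_congr rfl h1, Finset.prod_mul_distrib, Finset.prod_mul_distrib,
    Finset.prod_ite_eq', if_pos (Finset.mem_range.2 hk), ← Finset.prod_filter]
  congr 1
  rw [← Finset.prod_union]
  · refine Finset.prod_congr ?_ fun _ _ => rfl
    ext j
    simp
    omega
  · refine Finset.disjoint_left.2 fun j h3 h4 => ?_
    rw [Finset.mem_Ioo] at h3
    rw [Finset.mem_filter] at h4
    omega

end Hooks

section HookIdentity

theorem exists_cov_of_rowLen {nu : YoungDiagram} {k : ℕ}
    (hk : ∀ j, k = j + 1 → nu.rowLen k < nu.rowLen j) :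
    ∃ nu' : YoungDiagram, ∀ i, nu'.rowLen i = nu.rowLen i + if i = k then 1 else 0 := by
  have hr : Antitone fun i => nu.rowLen i + if i = k then 1 else 0 := by
    refine antitone_nat_of_succ_le fun i => ?_
    have h1 := nu.rowLen_anti i (i + 1) (by omega)
    have h2 := hk i
    split_ifs with h3 h4
    · omega
    · subst h3; have := h2 rfl; omega
    · omega
    · omega
  refine ⟨ofRows _ hr (nu.colLen 0 + k + 1), rowLen_ofRows _ hr ?_⟩
  rw [rowLen_eq_zero_iff.2 (by omega), if_neg (by omega)]

theorem sum_ups_div_hookProd (nu : YoungDiagram) (e f : ℚ) :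
    ∑ nu' ∈ ups nu, skewContPoly e nu' nu * skewContPoly f nu'.transpose nu.transpose /
      hookProd nu' = (e * f - nu.card) / hookProd nu := by
  obtain ⟨m, hm⟩ : ∃ m, m = nu.colLen 0 := ⟨_, rfl⟩
  have hrz : ∀ k, m ≤ k → nu.rowLen k = 0 := fun k hk => rowLen_eq_zero_iff.2 (hm ▸ hk)
  set v : ℕ → ℚ := fun k => (beta nu (m + 3) k : ℚ) with hv
  have hvlt : ∀ i j, i < j → j < m + 3 → v j < v i := fun i j h1 h2 => by
    simp only [hv]
    exact_mod_cast beta_lt h1 h2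
  have hvne : ∀ i j, i < m + 3 → j < m + 3 → j ≠ i → v i ≠ v j := fun i j h1 h2 h3 => by
    rcases lt_or_gt_of_ne h3 with h | h
    · exact (hvlt j i h h1).ne
    · exact (hvlt i j h h2).ne'
  have hinj : Set.InjOn v (Finset.range (m + 3)) := fun i hi j hj h => by
    by_contra hne
    exact hvne i j (by simpa using hi) (by simpa using hj) (Ne.symm hne) h
  have hv0 : v (m + 2) = 0 := by
    simp [hv, beta, hrz (m + 2) (by omega)]
  obtain ⟨w, hw⟩ : ∃ w : ℕ → ℚ, ∀ k, w k = (∏ j ∈ Finset.range (m + 2), (v k + 1 - v j)) /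
    ∏ j ∈ (Finset.range (m + 3)).erase k, (v k - v j) := ⟨_, fun _ => rfl⟩
  obtain ⟨s0, s1, s2⟩ := sum_eval_add_one_div m v hinj hv0 w hw
  have hratio : ∀ nu' : YoungDiagram, ∀ k, k < m + 3 →
      (∀ i, nu'.rowLen i = nu.rowLen i + if i = k then 1 else 0) →
      hookProd nu' * w k = hookProd nu := by
    intro nu' k hk hnu'
    have h1 := hookProd_mul nu (n := m + 3) (hrz _ (by omega))
    have h2 := hookProd_mul nu' (n := m + 3) (by
      rw [hnu', hrz _ (by omega), if_neg (by omega)])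
    have hb : ∀ i, beta nu' (m + 3) i = beta nu (m + 3) i + if i = k then 1 else 0 := fun i => by
      unfold beta; rw [hnu']; omega
    rw [prod_sub_update (m + 3) k hk v (fun i => (beta nu' (m + 3) i : ℚ))
      (fun i => by rw [hb]; push_cast; rfl) (fun j hj hjk => hvne k j hk hj hjk)] at h2
    have h3 : ∏ i ∈ Finset.range (m + 3), ((beta nu' (m + 3) i).factorial : ℚ) =
        (∏ i ∈ Finset.range (m + 3), ((beta nu (m + 3) i).factorial : ℚ)) * (v k + 1) := by
      have : ∀ i ∈ Finset.range (m + 3), ((beta nu' (m + 3) i).factorial : ℚ) =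
          ((beta nu (m + 3) i).factorial : ℚ) * if i = k then v k + 1 else 1 := fun i _ => by
        rw [hb]
        split_ifs with h
        · subst h
          rw [Nat.factorial_succ]
          push_cast
          ring
        · simp
      rw [Finset.prod_congr rfl this, Finset.prod_mul_distrib, Finset.prod_ite_eq',
        if_pos (Finset.mem_range.2 hk)]
    have h4 : ∏ j ∈ (Finset.range (m + 3)).erase k, (v k + 1 - v j) =
        (∏ j ∈ Finset.range (m + 2), (v k + 1 - v j)) * (v k + 1) := by
      have h5 := Finset.mul_prod_erase (Finset.range (m + 3)) (fun j => v k + 1 - v j)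
        (Finset.mem_range.2 hk)
      rw [Finset.prod_range_succ, hv0] at h5
      simpa using h5
    rw [h3, ← h1, Finset.prod_div_distrib, h4] at h2
    set D := ∏ i ∈ Finset.range (m + 3), ∏ j ∈ Finset.Ioo i (m + 3), (v i - v j) with hD
    have hD0 : D ≠ 0 := by
      rw [hD, Finset.prod_ne_zero_iff]
      intro i hi
      rw [Finset.prod_ne_zero_iff]
      intro j hj
      rw [Finset.mem_Ioo] at hj
      exact sub_ne_zero.2 (hvlt i j hj.1 hj.2).ne'
    have hvk : v k + 1 ≠ 0 := by
      simp only [hv]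
      positivity
    have h6 : (hookProd nu' * w k) * (D * (v k + 1)) = hookProd nu * (D * (v k + 1)) := by
      rw [hw]
      linear_combination h2
    exact mul_right_cancel₀ (mul_ne_zero hD0 hvk) h6
  have hex : ∀ nu' ∈ ups nu, ∃ k, ∀ i, nu'.rowLen i = nu.rowLen i + if i = k then 1 else 0 :=
    fun nu' h => cov_iff_rowLen.1 (mem_ups.1 h)
  choose! κ hκ using hex
  have hκlt : ∀ nu' ∈ ups nu, κ nu' < m + 3 := fun nu' h => by
    by_contra hc
    have h1 := hκ nu' h (κ nu')
    have h2 := hκ nu' h m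
    have h3 := nu'.rowLen_anti m (κ nu') (by omega)
    rw [hrz _ (by omega), if_pos rfl] at h1
    rw [hrz _ le_rfl, if_neg (by omega)] at h2
    omega
  have hmain : ∑ nu' ∈ ups nu, skewContPoly e nu' nu *
      skewContPoly f nu'.transpose nu.transpose / hookProd nu' =
      ∑ k ∈ Finset.range (m + 3),
        w k / hookProd nu * ((e + v k - (m + 2)) * (f - v k + (m + 2))) := by
    refine Finset.sum_of_injOn κ ?_ ?_ ?_ ?_
    · intro a ha b hb hab
      refine ext_rowLen fun i => ?_
      rw [hκ a ha, hκ b hb, hab]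
    · intro a ha
      simpa using hκlt a ha
    · intro k hk hk'
      rw [Finset.mem_range] at hk
      have : ∃ j, k = j + 1 ∧ nu.rowLen j ≤ nu.rowLen k := by
        by_contra! hc
        obtain ⟨nu', hnu'⟩ := exists_cov_of_rowLen hc
        have hmem : nu' ∈ ups nu := mem_ups.2 (cov_iff_rowLen.2 ⟨k, hnu'⟩)
        refine hk' ⟨nu', hmem, ?_⟩
        have h1 := hκ nu' hmem k
        have h2 := hnu' k
        by_contra hne
        rw [if_neg (Ne.symm hne)] at h1
        rw [if_pos rfl] at h2
        omega
      obtain ⟨j, rfl, hj⟩ := this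
      have hz : w (j + 1) = 0 := by
        rw [hw, Finset.prod_eq_zero (i := j) (by rw [Finset.mem_range]; omega), zero_div]
        have h1 := nu.rowLen_anti j (j + 1) (by omega)
        have : beta nu (m + 3) j = beta nu (m + 3) (j + 1) + 1 := by
          unfold beta; omega
        simp only [hv, this]
        push_cast
        ring
      rw [hz]
      ring
    · intro a ha
      have hk := hκlt a ha
      rw [skewContPoly_cov e (hκ a ha), skewContPoly_transpose_cov f (hκ a ha)]
      have h1 := hratio a _ hk (hκ a ha)
      have h2 : v (κ a) = nu.rowLen (κ a) + ((m : ℚ) + 2 - κ a) := by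
        simp only [hv, beta]
        rw [show m + 3 - 1 - κ a = m + 2 - κ a by omega]
        push_cast [Nat.cast_sub (show κ a ≤ m + 2 by omega)]
        ring
      have h3 := hookProd_ne_zero a
      have h4 := hookProd_ne_zero nu
      rw [h2]
      field_simp
      rw [← h1]
      ring
  have hsum : ∑ k ∈ Finset.range (m + 3), v k = nu.card + ((m : ℚ) + 2) * (m + 3) / 2 := by
    simp only [hv, beta]
    push_cast
    rw [Finset.sum_add_distrib, card_eq_sum_rowLen nu (N := m + 3) (hrz _ (by omega))]
    push_cast
    congr 1
    rw [← Nat.cast_sum, show ∑ x ∈ Finset.range (m + 3), (m + 2 - x) =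
      ∑ x ∈ Finset.range (m + 3), x from Finset.sum_range_reflect (fun i => i) (m + 3)]
    have := Finset.sum_range_id_mul_two (m + 3)
    have h2 : ((∑ i ∈ Finset.range (m + 3), i : ℕ) : ℚ) * 2 = (m + 3) * (m + 2) := by
      exact_mod_cast this
    linarith
  rw [hmain]
  have : ∀ k, w k / hookProd nu * ((e + v k - (m + 2)) * (f - v k + (m + 2))) =
      (((e - (m + 2)) * (f + (m + 2))) * w k + (f - e + 2 * (m + 2)) * (v k * w k) -
        v k ^ 2 * w k) / hookProd nu := fun k => by ring
  rw [Finset.sum_congr rfl fun k _ => this k, ← Finset.sum_div, Finset.sum_sub_distrib,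
    Finset.sum_add_distrib, ← Finset.mul_sum, ← Finset.mul_sum, s0, s1, s2, hsum]
  congr 1
  ring

end HookIdentity

section Coefficients

theorem lrCoeff_support {a g b : YoungDiagram} (h : lrCoeff a g b ≠ 0) :
    a ≤ b ∧ g ≤ b ∧ b.card = a.card + g.card := by
  rw [lrCoeff_eq_card_lrChains, Finset.card_ne_zero] at h
  obtain ⟨R, hR⟩ := h
  rw [mem_lrChains] at hR
  exact ⟨hR.le, hR.content_le, hR.card⟩

theorem P_eq_sum (lam mu : YoungDiagram) (e f : ℚ) {N : ℕ} (hN : lam.card + mu.card = N) :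
    P lam mu e f = ∑ nu ∈ level N, (lrCoeff lam.transpose mu nu.transpose : ℚ) *
      skewContPoly e nu lam * skewContPoly f nu.transpose mu / hookProd nu := by
  rw [P]
  refine finsum_eq_sum_of_support_subset _ fun nu h => ?_
  rw [Function.mem_support] at h
  have : lrCoeff lam.transpose mu nu.transpose ≠ 0 := fun h0 => h (by simp [h0])
  have := (lrCoeff_support this).2.2
  rw [card_transpose, card_transpose] at this
  simp [this, hN]

theorem sum_ups_lrCoeff_transpose (a g b : YoungDiagram) :
    ∑ a' ∈ ups a, lrCoeff a'.transpose g b.transpose =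
      ∑ b' ∈ downs b, lrCoeff a.transpose g b'.transpose := by
  have h := sum_ups_lrCoeff a.transpose g b.transpose
  refine Eq.trans ?_ (h.trans ?_)
  · refine Finset.sum_nbij' YoungDiagram.transpose YoungDiagram.transpose ?_ ?_ ?_ ?_ ?_
    · intro x hx
      rw [mem_ups] at hx ⊢
      exact hx.transpose
    · intro x hx
      rw [mem_ups] at hx ⊢
      simpa using hx.transpose
    all_goals simp
  · refine Finset.sum_nbij' YoungDiagram.transpose YoungDiagram.transpose ?_ ?_ ?_ ?_ ?_
    · intro x hx
      rw [mem_downs] at hx ⊢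
      simpa using hx.transpose
    · intro x hx
      rw [mem_downs] at hx ⊢
      exact hx.transpose
    all_goals simp

theorem sum_ups_P (lam mu : YoungDiagram) (e f : ℚ) :
    ∑ lam' ∈ ups lam, skewContPoly e lam' lam * P lam' mu e f =
      (e * f - lam.card - mu.card) * P lam mu e f := by
  set N := lam.card + mu.card with hN
  have h1 : ∀ lam' ∈ ups lam, skewContPoly e lam' lam * P lam' mu e f =
      ∑ nu' ∈ level (N + 1), (lrCoeff lam'.transpose mu nu'.transpose : ℚ) *
        (skewContPoly e nu' lam * skewContPoly f nu'.transpose mu / hookProd nu') := by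
    intro lam' hl
    have hc := mem_ups.1 hl
    rw [P_eq_sum lam' mu e f (N := N + 1) (by rw [hc.2]; omega), Finset.mul_sum]
    refine Finset.sum_congr rfl fun nu' _ => ?_
    by_cases h0 : lrCoeff lam'.transpose mu nu'.transpose = 0
    · simp [h0]
    · have hle := (lrCoeff_support h0).1
      rw [YoungDiagram.transpose_le_iff] at hle
      rw [← skewContPoly_mul e hc.1 hle]
      ring
  rw [Finset.sum_congr rfl h1, Finset.sum_comm]
  have h2 : ∀ nu' ∈ level (N + 1), ∑ lam' ∈ ups lam,
      (lrCoeff lam'.transpose mu nu'.transpose : ℚ) *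
        (skewContPoly e nu' lam * skewContPoly f nu'.transpose mu / hookProd nu') =
      ∑ nu ∈ downs nu', (lrCoeff lam.transpose mu nu.transpose : ℚ) *
        (skewContPoly e nu' lam * skewContPoly f nu'.transpose mu / hookProd nu') := by
    intro nu' _
    rw [← Finset.sum_mul, ← Finset.sum_mul, ← Nat.cast_sum, ← Nat.cast_sum,
      sum_ups_lrCoeff_transpose]
  rw [Finset.sum_congr rfl h2, Finset.sum_comm' (t' := level N) (s' := ups), P_eq_sum lam mu e f rfl,
    Finset.mul_sum]
  · refine Finset.sum_congr rfl fun nu hnu => ?_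
    by_cases h0 : lrCoeff lam.transpose mu nu.transpose = 0
    · simp [h0]
    · obtain ⟨hle, hle', hcard⟩ := lrCoeff_support h0
      rw [YoungDiagram.transpose_le_iff] at hle
      have h3 := sum_ups_div_hookProd nu e f
      have h4 : (nu.card : ℚ) = lam.card + mu.card := by
        rw [mem_level] at hnu
        rw [hnu]
        push_cast
        rfl
      calc _ = ∑ nu' ∈ ups nu, (lrCoeff lam.transpose mu nu.transpose : ℚ) *
            (skewContPoly e nu lam * skewContPoly f nu.transpose mu) *
            (skewContPoly e nu' nu * skewContPoly f nu'.transpose nu.transpose / hookProd nu') := by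
            refine Finset.sum_congr rfl fun nu' hnu' => ?_
            have hc := mem_ups.1 hnu'
            rw [← skewContPoly_mul e hle hc.1, ← skewContPoly_mul f hle' hc.transpose.1]
            ring
        _ = _ := by
            rw [← Finset.mul_sum, h3, h4]
            ring
  · intro nu' nu
    simp only [mem_level, mem_downs, mem_ups]
    constructor
    · rintro ⟨h, hc⟩
      exact ⟨hc, by have := hc.2; omega⟩
    · rintro ⟨hc, h⟩
      exact ⟨by rw [hc.2, h], hc⟩

theorem skewContPoly_eq_zero {n : ℕ} {a b : YoungDiagram} (ha : a.rowLen n = 0)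
    (hb : b.rowLen n ≠ 0) : skewContPoly n b a = 0 := by
  refine Finset.prod_eq_zero (i := (n, 0)) ?_ (by simp)
  rw [mem_sdiff_iff]
  omega

theorem P_eq_sum_below {lam mu : YoungDiagram} {e f : ℕ} (hl : lam.rowLen e = 0)
    (hm : mu.rowLen f = 0) : P lam mu e f =
      ∑ nu ∈ (level (lam.card + mu.card)).filter (fun nu => nu ≤ rect e f),
        (lrCoeff lam.transpose mu nu.transpose : ℚ) *
        skewContPoly e nu lam * skewContPoly f nu.transpose mu / hookProd nu := by
  rw [P_eq_sum lam mu e f rfl, Finset.sum_filter]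
  refine Finset.sum_congr rfl fun nu _ => ?_
  split_ifs with h
  · rfl
  · rw [le_rect_iff, not_and_or] at h
    rcases h with h | h
    · rw [skewContPoly_eq_zero hl h]; ring
    · rw [← YoungDiagram.rowLen_transpose] at h
      rw [skewContPoly_eq_zero hm h]; ring

theorem P_support {lam mu : YoungDiagram} {e f : ℕ} (hl : lam.rowLen e = 0)
    (hm : mu.rowLen f = 0) (h : P lam mu e f ≠ 0) :
    lam ≤ rect e f ∧ mu ≤ rect f e ∧ lam.card + mu.card ≤ e * f := by
  rw [P_eq_sum_below hl hm] at h
  obtain ⟨nu, hnu, hne⟩ := Finset.exists_ne_zero_of_sum_ne_zero h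
  rw [Finset.mem_filter, mem_level] at hnu
  have : lrCoeff lam.transpose mu nu.transpose ≠ 0 := fun h0 => hne (by simp [h0])
  obtain ⟨h1, h2, -⟩ := lrCoeff_support this
  rw [YoungDiagram.transpose_le_iff] at h1
  refine ⟨h1.trans hnu.2, h2.trans ?_, ?_⟩
  · rw [← rect_transpose, YoungDiagram.transpose_le_iff]
    exact hnu.2
  · rw [← hnu.1, ← card_rect]
    exact card_le_card hnu.2

theorem hookProd_rect (e f : ℕ) : hookProd (rect e f) = contPoly e (rect e f) := by
  rw [hookProd, contPoly]
  refine Finset.prod_nbij' (fun c => (c.1, f - 1 - c.2)) (fun c => (c.1, f - 1 - c.2)) ?_ ?_ ?_ ?_ ?_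
  all_goals
    rintro ⟨i, j⟩ hc
    rw [YoungDiagram.mem_cells, mem_rect] at hc
  · rw [YoungDiagram.mem_cells, mem_rect]; simp only; omega
  · rw [YoungDiagram.mem_cells, mem_rect]; simp only; omega
  · simp only [Prod.mk.injEq, true_and]; omega
  · simp only [Prod.mk.injEq, true_and]; omega
  · rw [← YoungDiagram.rowLen_transpose, rect_transpose, rowLen_rect, rowLen_rect, if_pos hc.1,
      if_pos hc.2]
    simp only
    rw [show f + e - i - j - 1 = e + (f - 1 - j) - i by omega, Nat.cast_sub (by omega)]
    push_cast
    ring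

theorem skewContPoly_rect_compl {lam mu : YoungDiagram} {e f : ℕ} (hl : lam ≤ rect e f)
    (h : ∀ i < f, mu.rowLen i + lam.colLen (f - 1 - i) = e) :
    skewContPoly f (rect f e) mu = contPoly e lam := by
  have hmem : ∀ i j, (i, j) ∈ lam.cells → i < e ∧ j < f := fun i j h => by
    have := hl ((YoungDiagram.mem_cells _).1 h)
    rwa [mem_rect] at this
  rw [skewContPoly, contPoly]
  refine Finset.prod_nbij' (fun c => (e - 1 - c.2, f - 1 - c.1))
    (fun c => (f - 1 - c.2, e - 1 - c.1)) ?_ ?_ ?_ ?_ ?_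
  · rintro ⟨i, j⟩ hc
    rw [mem_sdiff_iff, rowLen_rect] at hc
    rw [YoungDiagram.mem_cells, YoungDiagram.mem_iff_lt_colLen]
    split_ifs at hc with hi
    · have := h i hi
      simp only
      omega
    · omega
  · rintro ⟨i, j⟩ hc
    have hij := hmem i j hc
    rw [YoungDiagram.mem_cells, YoungDiagram.mem_iff_lt_colLen] at hc
    have h1 := h (f - 1 - j) (by omega)
    rw [show f - 1 - (f - 1 - j) = j by omega] at h1
    rw [mem_sdiff_iff, rowLen_rect, if_pos (by omega)]
    simp only
    omega
  · rintro ⟨i, j⟩ hc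
    rw [mem_sdiff_iff, rowLen_rect] at hc
    simp only [Prod.mk.injEq]
    split_ifs at hc <;> omega
  · rintro ⟨i, j⟩ hc
    have hij := hmem i j hc
    simp only [Prod.mk.injEq]
    omega
  · rintro ⟨i, j⟩ hc
    rw [mem_sdiff_iff, rowLen_rect] at hc
    split_ifs at hc with hi
    · simp only
      rw [Nat.cast_sub (by omega), Nat.cast_sub (by omega), Nat.cast_sub (by omega),
        Nat.cast_sub (by omega)]
      push_cast
      ring
    · omega

theorem P_top {lam mu : YoungDiagram} {e f : ℕ} (hl : lam ≤ rect e f) (hm : mu ≤ rect f e)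
    (hcard : lam.card + mu.card = e * f) :
    P lam mu e f = if ∀ i < f, mu.rowLen i + lam.colLen (f - 1 - i) = e then 1 else 0 := by
  rw [P_eq_sum_below (le_rect_iff.1 hl).1 (le_rect_iff.1 hm).1, Finset.sum_eq_single (rect e f)]
  · have hl' : lam.transpose ≤ rect f e := by
      rw [← rect_transpose, YoungDiagram.transpose_le_iff]
      exact hl
    rw [rect_transpose, lrCoeff_rect hl' hm]
    simp only [YoungDiagram.rowLen_transpose]
    split_ifs with h
    · rw [skewContPoly_rect_compl hl h]
      have h1 : skewContPoly e (rect e f) lam * contPoly e lam = hookProd (rect e f) := by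
        rw [hookProd_rect, contPoly, contPoly, skewContPoly,
          Finset.prod_sdiff (YoungDiagram.cells_subset_iff.2 hl)]
      rw [Nat.cast_one, one_mul, h1, div_self (hookProd_ne_zero _)]
    · simp
  · intro nu hnu hne
    rw [Finset.mem_filter, mem_level, hcard, ← card_rect] at hnu
    exact absurd (eq_of_le_of_card hnu.2 hnu.1.ge) hne
  · intro h
    refine absurd ?_ h
    rw [Finset.mem_filter, mem_level, hcard, card_rect]
    exact ⟨rfl, le_rfl⟩

end Coefficients

section Schur

/-- `HorizontalStrip a b`: the skew shape `b / a` is a horizontal strip. -/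
def HorizontalStrip (a b : YoungDiagram) : Prop :=
  a ≤ b ∧ ∀ i j, (i + 1, j) ∈ b → (i, j) ∈ a

variable {A B : Type*} [CommRing A] [CommRing B]

/-- The Schur polynomial over an arbitrary commutative ring. -/
def sch (lam : YoungDiagram) {n : ℕ} (x : Fin n → A) : A :=
  ∑ T : {T : lam.cells → Fin n // IsSSYT lam T}, ∏ c : lam.cells, x (T.1 c)

theorem schur_eq_sch (lam : YoungDiagram) {n : ℕ} (x : Fin n → ℚ) : schur lam x = sch lam x :=
  finsum_eq_sum_of_fintype _

theorem map_sch (φ : A →+* B) (lam : YoungDiagram) {n : ℕ} (x : Fin n → A) :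
    φ (sch lam x) = sch lam (fun i => φ (x i)) := by
  simp [sch, map_sum, map_prod]

theorem IsSSYT.mono {lam : YoungDiagram} {n : ℕ} {T : lam.cells → Fin n} (hT : IsSSYT lam T)
    {a b : lam.cells} (h : (a : ℕ × ℕ) ≤ b) : T a ≤ T b := by
  obtain ⟨⟨i, j⟩, ha⟩ := a
  obtain ⟨⟨i', j'⟩, hb⟩ := b
  rw [Subtype.coe_mk, Subtype.coe_mk, Prod.mk_le_mk] at h
  have hc : (i, j') ∈ lam.cells := by
    rw [YoungDiagram.mem_cells] at hb ⊢
    exact lam.isLowerSet (Prod.mk_le_mk.2 ⟨h.1, le_rfl⟩) hb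
  refine (hT.1 ⟨(i, j), ha⟩ ⟨(i, j'), hc⟩ rfl h.2).trans ?_
  rcases h.1.eq_or_lt with rfl | hlt
  · exact le_rfl
  · exact (hT.2 ⟨(i, j'), hc⟩ ⟨(i', j'), hb⟩ rfl hlt).le

/-- The subdiagram of cells whose entry is not maximal. -/
def IsSSYT.inner {lam : YoungDiagram} {n : ℕ} {T : lam.cells → Fin (n + 1)}
    (hT : IsSSYT lam T) : YoungDiagram :=
  ⟨lam.cells.filter (fun c => ∃ h : c ∈ lam.cells, T ⟨c, h⟩ ≠ Fin.last n), by
    intro p q hle hp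
    rw [Finset.mem_coe, Finset.mem_filter] at hp ⊢
    obtain ⟨hp, hq'⟩ := hp
    have hq : q ∈ lam.cells := by
      rw [YoungDiagram.mem_cells] at hp ⊢
      exact lam.isLowerSet hle hp
    refine ⟨hq, hq, ?_⟩
    obtain ⟨_, h⟩ := hq'
    have := hT.mono (a := ⟨q, hq⟩) (b := ⟨p, hp⟩) hle
    exact (this.trans_lt (Fin.lt_last_iff_ne_last.2 h)).ne⟩

theorem IsSSYT.mem_inner {lam : YoungDiagram} {n : ℕ} {T : lam.cells → Fin (n + 1)}
    (hT : IsSSYT lam T) {c : ℕ × ℕ} :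
    c ∈ hT.inner ↔ ∃ h : c ∈ lam.cells, T ⟨c, h⟩ ≠ Fin.last n := by
  rw [← YoungDiagram.mem_cells]
  simp only [inner, Finset.mem_filter, and_iff_right_iff_imp]
  exact fun h => h.1

theorem IsSSYT.horizontalStrip_inner {lam : YoungDiagram} {n : ℕ} {T : lam.cells → Fin (n + 1)}
    (hT : IsSSYT lam T) : HorizontalStrip hT.inner lam := by
  refine ⟨fun c hc => ?_, fun i j h => ?_⟩
  · exact (YoungDiagram.mem_cells _).1 (hT.mem_inner.1 hc).1
  · have h' : (i, j) ∈ lam.cells := by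
      rw [YoungDiagram.mem_cells]
      exact lam.isLowerSet (Prod.mk_le_mk.2 ⟨i.le_succ, le_rfl⟩) h
    rw [hT.mem_inner]
    refine ⟨h', ?_⟩
    exact ((hT.2 ⟨(i, j), h'⟩ ⟨(i + 1, j), (YoungDiagram.mem_cells _).2 h⟩ rfl i.lt_succ_self).trans_le
      (Fin.le_last _)).ne

/-- Extend a filling by the maximal entry. -/
def extendLast {a : YoungDiagram} (lam : YoungDiagram) {n : ℕ} (T : a.cells → Fin n) :
    lam.cells → Fin (n + 1) :=
  fun c => if h : (c : ℕ × ℕ) ∈ a.cells then (T ⟨c, h⟩).castSucc else Fin.last n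

theorem IsSSYT.extendLast {a lam : YoungDiagram} {n : ℕ} {T : a.cells → Fin n}
    (hT : IsSSYT a T) (h : HorizontalStrip a lam) : IsSSYT lam (extendLast lam T) := by
  have key : ∀ p q : lam.cells, (p : ℕ × ℕ) ≤ q → (q : ℕ × ℕ) ∈ a.cells →
      (p : ℕ × ℕ) ∈ a.cells := by
    intro p q hpq hq
    rw [YoungDiagram.mem_cells] at hq ⊢
    exact a.isLowerSet hpq hq
  constructor
  · intro p q h1 h2
    rw [ChernTensor.extendLast, ChernTensor.extendLast]
    by_cases hq : (q : ℕ × ℕ) ∈ a.cells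
    · have hp := key p q ⟨h1.le, h2⟩ hq
      rw [dif_pos hp, dif_pos hq, Fin.castSucc_le_castSucc_iff]
      exact hT.1 _ _ h1 h2
    · rw [dif_neg hq]
      exact Fin.le_last _
  · intro p q h1 h2
    rw [ChernTensor.extendLast, ChernTensor.extendLast]
    by_cases hq : (q : ℕ × ℕ) ∈ a.cells
    · have hp := key p q ⟨h2.le, h1.le⟩ hq
      rw [dif_pos hp, dif_pos hq, Fin.castSucc_lt_castSucc_iff]
      exact hT.2 _ _ h1 h2
    · have hp : (p : ℕ × ℕ) ∈ a.cells := by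
        rw [YoungDiagram.mem_cells]
        refine h.2 _ _ (lam.isLowerSet (?_ : _ ≤ (q : ℕ × ℕ)) ((YoungDiagram.mem_cells _).1 q.2))
        exact ⟨h2, h1.le⟩
      rw [dif_neg hq, dif_pos hp]
      exact Fin.castSucc_lt_last _

theorem sch_succ (lam : YoungDiagram) {n : ℕ} (x : Fin (n + 1) → A) :
    sch lam x = ∑ a ∈ (below lam).filter (fun a => HorizontalStrip a lam),
      sch a (fun i : Fin n => x i.castSucc) * x (Fin.last n) ^ (lam.card - a.card) := by
  rw [sch, ← Finset.sum_fiberwise_of_maps_to (g := fun T => T.2.inner)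
    (t := (below lam).filter (fun a => HorizontalStrip a lam))]
  · refine Finset.sum_congr rfl fun a ha => ?_
    rw [Finset.mem_filter] at ha
    have hle := YoungDiagram.cells_subset_iff.2 ha.2.1
    rw [sch, Finset.sum_mul]
    symm
    refine Finset.sum_bij (fun T _ => ⟨extendLast lam T.1, T.2.extendLast ha.2⟩) ?_ ?_ ?_ ?_
    · rintro ⟨T, hT⟩ -
      rw [Finset.mem_filter]
      refine ⟨Finset.mem_univ _, ?_⟩
      refine YoungDiagram.ext (Finset.ext fun c => ?_)
      rw [YoungDiagram.mem_cells, IsSSYT.mem_inner]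
      constructor
      · rintro ⟨h, h'⟩
        by_contra hc
        exact h' (dif_neg hc)
      · intro hc
        refine ⟨hle hc, ?_⟩
        change extendLast lam T ⟨c, hle hc⟩ ≠ Fin.last n
        rw [show extendLast lam T ⟨c, hle hc⟩ = (T ⟨c, hc⟩).castSucc from dif_pos hc]
        exact (Fin.castSucc_lt_last _).ne
    · rintro ⟨T, hT⟩ - ⟨T', hT'⟩ - h
      rw [Subtype.mk.injEq] at h ⊢
      funext ⟨c, hc⟩
      have := congrFun h ⟨c, hle hc⟩
      simpa [extendLast, hc] using this
    · rintro ⟨T, hT⟩ h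
      rw [Finset.mem_filter] at h
      obtain ⟨-, h⟩ := h
      have hne : ∀ c : a.cells, T ⟨c, hle c.2⟩ ≠ Fin.last n := by
        rintro ⟨c, hc⟩
        rw [YoungDiagram.mem_cells, ← h, IsSSYT.mem_inner] at hc
        exact hc.2
      refine ⟨⟨fun c => (T ⟨c, hle c.2⟩).castPred (hne c), ?_, ?_⟩, Finset.mem_univ _, ?_⟩
      · intro p q h1 h2
        rw [Fin.castPred_le_castPred_iff]
        exact hT.1 _ _ h1 h2
      · intro p q h1 h2
        rw [Fin.castPred_lt_castPred_iff]
        exact hT.2 _ _ h1 h2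
      · rw [Subtype.mk.injEq]
        funext ⟨c, hc⟩
        rw [extendLast]
        split_ifs with h'
        · simp
        · rw [YoungDiagram.mem_cells, ← h, IsSSYT.mem_inner] at h'
          push Not at h'
          exact (h' hc).symm
    · rintro ⟨T, hT⟩ -
      let g : ℕ × ℕ → A := fun c =>
        if h : c ∈ a.cells then x (T ⟨c, h⟩).castSucc else x (Fin.last n)
      have h1 : ∏ c : lam.cells, x (extendLast lam T c) = ∏ c ∈ lam.cells, g c := by
        rw [← Finset.prod_coe_sort lam.cells g]
        refine Finset.prod_congr rfl fun c _ => ?_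
        rw [extendLast]
        simp only [g]
        split_ifs <;> rfl
      rw [h1, ← Finset.prod_sdiff hle, mul_comm]
      congr 1
      · rw [Finset.prod_congr rfl (g := fun _ => x (Fin.last n)), Finset.prod_const,
          Finset.card_sdiff_of_subset hle]
        intro c hc
        exact dif_neg (Finset.mem_sdiff.1 hc).2
      · rw [← Finset.prod_coe_sort a.cells g]
        refine Finset.prod_congr rfl fun c _ => ?_
        simp only [g]
        rw [dif_pos c.2]
  · intro T _
    rw [Finset.mem_filter, mem_below]
    exact ⟨T.2.horizontalStrip_inner.1, T.2.horizontalStrip_inner⟩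

theorem sch_zero {lam : YoungDiagram} (h : lam.rowLen 0 = 0) (x : Fin 0 → A) :
    sch lam x = 1 := by
  have : IsEmpty lam.cells := by
    refine ⟨fun ⟨⟨i, j⟩, hc⟩ => ?_⟩
    rw [YoungDiagram.mem_cells, YoungDiagram.mem_iff_lt_rowLen] at hc
    have := lam.rowLen_anti 0 i (Nat.zero_le _)
    omega
  have hu : Unique {T : lam.cells → Fin 0 // IsSSYT lam T} :=
    ⟨⟨⟨fun c => isEmptyElim c, fun c => isEmptyElim c, fun c => isEmptyElim c⟩⟩,
      fun T => Subtype.ext (funext fun c => isEmptyElim c)⟩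
  rw [sch]
  simp

theorem sch_eq_zero {lam : YoungDiagram} {n : ℕ} (h : lam.rowLen n ≠ 0) (x : Fin n → A) :
    sch lam x = 0 := by
  induction n generalizing lam with
  | zero =>
    have hc : (0, 0) ∈ lam.cells := by
      rw [YoungDiagram.mem_cells, YoungDiagram.mem_iff_lt_rowLen]
      omega
    rw [sch]
    exact Finset.sum_eq_zero fun T _ => (T.1 ⟨_, hc⟩).elim0
  | succ n ih =>
    rw [sch_succ]
    refine Finset.sum_eq_zero fun a ha => ?_
    rw [Finset.mem_filter] at ha
    rw [ih, zero_mul]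
    have := ha.2.2 n 0
    rw [YoungDiagram.mem_iff_lt_rowLen, YoungDiagram.mem_iff_lt_rowLen] at this
    omega

end Schur

section Bialternant

variable {A B : Type*} [CommRing A] [CommRing B]

/-- The alternant `det (x_i ^ l_j)`. -/
def alt {n : ℕ} (l : Fin n → ℕ) (x : Fin n → A) : A :=
  Matrix.det (Matrix.of fun j i => x i ^ l j)

theorem alt_val_eq_det_vandermonde {n : ℕ} (x : Fin n → A) :
    alt (fun j => (j : ℕ)) x = (Matrix.vandermonde x).det := by
  rw [alt, ← Matrix.det_transpose]
  rfl

theorem map_alt (φ : A →+* B) {n : ℕ} (l : Fin n → ℕ) (x : Fin n → A) :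
    φ (alt l x) = alt l (fun i => φ (x i)) := by
  rw [alt, RingHom.map_det, alt]
  congr 1
  ext i j
  simp

theorem det_sum_rows {n : ℕ} {ι : Type*} (S : Fin n → Finset ι)
    (g : Fin n → ι → Fin n → A) :
    Matrix.det (Matrix.of fun j i => ∑ m ∈ S j, g j m i) =
      ∑ p ∈ Fintype.piFinset S, Matrix.det (Matrix.of fun j i => g j (p j) i) := by
  have h := (Matrix.detRowAlternating (n := Fin n) (R := A)).toMultilinearMap.map_sum_finset
    (fun j m => g j m) S
  refine Eq.trans ?_ h
  change Matrix.det _ = Matrix.det _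
  congr 1
  ext j i
  simp

theorem alt_succ {n : ℕ} (l : Fin (n + 1) → ℕ) (hl : Monotone l) (x : Fin (n + 1) → A) :
    alt l x = (∏ i : Fin n, (x (Fin.last n) - x i.castSucc)) * (x (Fin.last n) ^ l 0 *
      ∑ p ∈ Fintype.piFinset (fun j : Fin n => Finset.Ico (l j.castSucc) (l j.succ)),
        (∏ j : Fin n, x (Fin.last n) ^ (l j.succ - 1 - p j)) * alt p (fun i => x i.castSucc)) := by
  set y := x (Fin.last n) with hy
  let B : Matrix (Fin (n + 1)) (Fin (n + 1)) A := Matrix.of fun j i =>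
    Fin.cases (x i ^ l 0) (fun j : Fin n => (x i - y) *
      ∑ m ∈ Finset.Ico (l j.castSucc) (l j.succ), x i ^ m * y ^ (l j.succ - 1 - m)) j
  have h1 : alt l x = B.det := by
    refine Matrix.det_eq_of_forall_row_eq_smul_add_pred
      (fun j => y ^ (l j.succ - l j.castSucc)) (fun i => rfl) fun j i => ?_
    simp only [B, Matrix.of_apply, Fin.cases_succ]
    rw [mul_geom_sum₂_Ico _ _ (hl (Fin.castSucc_lt_succ).le)]
    ring
  have h2 : B.submatrix Fin.succ Fin.castSucc = Matrix.of fun j i =>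
      (x i.castSucc - y) * Matrix.of (fun (j i : Fin n) =>
        ∑ m ∈ Finset.Ico (l j.castSucc) (l j.succ),
          y ^ (l j.succ - 1 - m) * x i.castSucc ^ m) j i := by
    ext j i
    simp [B, mul_comm]
  rw [h1, Matrix.det_succ_column B (Fin.last n), Finset.sum_eq_single 0]
  · have h3 : B.submatrix (Fin.succAbove 0) (Fin.last n).succAbove =
        B.submatrix Fin.succ Fin.castSucc := by
      ext j i
      simp
    rw [h3, h2, Matrix.det_mul_row, det_sum_rows]
    have h4 : ∏ i : Fin n, (x i.castSucc - y) = (-1) ^ n * ∏ i : Fin n, (y - x i.castSucc) := by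
      rw [← Fin.prod_const n (-1 : A), ← Finset.prod_mul_distrib]
      simp
    have h5 : ∀ p : Fin n → ℕ, Matrix.det (Matrix.of fun j i : Fin n =>
        y ^ (l j.succ - 1 - p j) * x i.castSucc ^ p j) =
        (∏ j : Fin n, y ^ (l j.succ - 1 - p j)) * alt p (fun i => x i.castSucc) :=
      fun p => Matrix.det_mul_column _ _
    simp only [h5]
    rw [h4]
    have h6 : ((-1 : A) ^ n) * (-1) ^ n = 1 := by
      rw [← mul_pow]; simp
    have h7 : B 0 (Fin.last n) = y ^ l 0 := rfl
    rw [h7, Fin.val_zero, Fin.val_last, zero_add]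
    linear_combination (y ^ l 0 * (∏ i : Fin n, (y - x i.castSucc)) *
      ∑ p ∈ Fintype.piFinset (fun j : Fin n => Finset.Ico (l j.castSucc) (l j.succ)),
        (∏ j : Fin n, y ^ (l j.succ - 1 - p j)) * alt p (fun i => x i.castSucc)) * h6
  · intro j _ hj
    obtain ⟨j, rfl⟩ := Fin.exists_succ_eq.2 hj
    have : B j.succ (Fin.last n) = 0 := by simp [B, hy]
    rw [this]
    ring
  · simp

theorem alt_val_succ {n : ℕ} (x : Fin (n + 1) → A) :
    alt (fun j => (j : ℕ)) x = (∏ i : Fin n, (x (Fin.last n) - x i.castSucc)) *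
      alt (fun j => (j : ℕ)) (fun i : Fin n => x i.castSucc) := by
  rw [alt_succ _ Fin.val_strictMono.monotone]
  simp only [Fin.val_castSucc, Fin.val_succ, Nat.Ico_succ_singleton, Fintype.piFinset_singleton]
  simp

/-- The exponents of the alternant attached to a diagram with at most `n` rows. -/
def expo (lam : YoungDiagram) (n : ℕ) (j : Fin n) : ℕ :=
  lam.rowLen (n - 1 - j) + j

theorem monotone_expo (lam : YoungDiagram) (n : ℕ) : Monotone (expo lam n) := by
  intro i j h
  have h' : (i : ℕ) ≤ j := h
  have := lam.rowLen_anti (n - 1 - j) (n - 1 - i) (by omega)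
  rw [expo, expo]
  omega

theorem expo_injective {a b : YoungDiagram} {n : ℕ} (ha : a.rowLen n = 0) (hb : b.rowLen n = 0)
    (h : expo a n = expo b n) : a = b := by
  refine ext_rowLen fun i => ?_
  rcases lt_or_ge i n with hi | hi
  · have := congrFun h ⟨n - 1 - i, by omega⟩
    simp only [expo] at this
    rw [show n - 1 - (n - 1 - i) = i by omega] at this
    omega
  · have h1 := a.rowLen_anti n i hi
    have h2 := b.rowLen_anti n i hi
    omega

theorem horizontalStrip_iff {a b : YoungDiagram} :
    HorizontalStrip a b ↔ ∀ i, a.rowLen i ≤ b.rowLen i ∧ b.rowLen (i + 1) ≤ a.rowLen i := by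
  rw [HorizontalStrip, le_iff_rowLen, forall_and]
  refine and_congr_right fun _ => ?_
  simp only [YoungDiagram.mem_iff_lt_rowLen]
  refine forall_congr' fun i => ⟨fun h => ?_, fun h j hj => hj.trans_le h⟩
  by_contra! hc
  exact lt_irrefl _ (h _ hc)

theorem alt_expo_succ {lam : YoungDiagram} {n : ℕ} (hl : lam.rowLen (n + 1) = 0)
    (x : Fin (n + 1) → A) :
    alt (expo lam (n + 1)) x = (∏ i : Fin n, (x (Fin.last n) - x i.castSucc)) *
      ∑ a ∈ (below lam).filter (fun a => HorizontalStrip a lam ∧ a.rowLen n = 0),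
        alt (expo a n) (fun i : Fin n => x i.castSucc) *
          x (Fin.last n) ^ (lam.card - a.card) := by
  rw [alt_succ _ (monotone_expo _ _), Finset.mul_sum]
  congr 1
  symm
  refine Finset.sum_bij (fun a _ => expo a n) ?_ ?_ ?_ ?_
  · intro a ha
    rw [Finset.mem_filter, horizontalStrip_iff] at ha
    rw [Fintype.mem_piFinset]
    intro j
    rw [Finset.mem_Ico]
    have h := ha.2.1 (n - 1 - j)
    have hj := j.2
    simp only [expo, Fin.val_castSucc, Fin.val_succ]
    rw [show n + 1 - 1 - (j : ℕ) = n - 1 - j + 1 by omega,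
      show n + 1 - 1 - ((j : ℕ) + 1) = n - 1 - j by omega]
    omega
  · intro a ha b hb h
    exact expo_injective (Finset.mem_filter.1 ha).2.2 (Finset.mem_filter.1 hb).2.2 h
  · intro p hp
    rw [Fintype.mem_piFinset] at hp
    let r : ℕ → ℕ := fun i => if h : i < n then p ⟨n - 1 - i, by omega⟩ - (n - 1 - i) else 0
    have hp' : ∀ i (h : i < n), lam.rowLen (i + 1) + (n - 1 - i) ≤ p ⟨n - 1 - i, by omega⟩ ∧
        p ⟨n - 1 - i, by omega⟩ ≤ lam.rowLen i + (n - 1 - i) := by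
      intro i h
      have := hp ⟨n - 1 - i, by omega⟩
      rw [Finset.mem_Ico] at this
      simp only [expo, Fin.castSucc_mk, Fin.succ_mk] at this
      rw [show n + 1 - 1 - (n - 1 - i) = i + 1 by omega,
        show n + 1 - 1 - (n - 1 - i + 1) = i by omega] at this
      omega
    have hr : ∀ i, r i ≤ lam.rowLen i ∧ lam.rowLen (i + 1) ≤ r i := by
      intro i
      simp only [r]
      split_ifs with h
      · have := hp' i h
        omega
      · have := lam.rowLen_anti (n + 1) (i + 1) (by omega)
        omega
    have hanti : Antitone r := antitone_nat_of_succ_le fun i => (hr (i + 1)).1.trans (hr i).2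
    have hn : r n = 0 := dif_neg (lt_irrefl n)
    refine ⟨ofRows r hanti n, ?_, ?_⟩
    · rw [Finset.mem_filter, horizontalStrip_iff, mem_below, le_iff_rowLen]
      simp only [rowLen_ofRows r hanti hn]
      exact ⟨fun i => (hr i).1, hr, hn⟩
    · funext j
      have hj := j.2
      rw [expo, rowLen_ofRows r hanti hn]
      simp only [r]
      rw [dif_pos (by omega)]
      have := hp' (n - 1 - j) (by omega)
      simp only [show n - 1 - (n - 1 - (j : ℕ)) = j by omega, Fin.eta] at this ⊢
      omega
  · intro a ha
    rw [Finset.mem_filter, horizontalStrip_iff] at ha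
    rw [Finset.prod_pow_eq_pow_sum, ← mul_assoc, ← pow_add, mul_comm]
    congr 2
    have h1 : ∑ j : Fin n, (expo lam (n + 1) j.succ - 1 - expo a n j) =
        ∑ i ∈ Finset.range n, (lam.rowLen i - a.rowLen i) := by
      rw [← Finset.sum_range_reflect, ← Fin.sum_univ_eq_sum_range
        (fun j => lam.rowLen (n - 1 - j) - a.rowLen (n - 1 - j))]
      refine Finset.sum_congr rfl fun j _ => ?_
      have hj := j.2
      simp only [expo, Fin.val_succ]
      rw [show n + 1 - 1 - ((j : ℕ) + 1) = n - 1 - j by omega]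
      omega
    have h2 : ∑ i ∈ Finset.range n, (lam.rowLen i - a.rowLen i) +
        ∑ i ∈ Finset.range n, a.rowLen i = ∑ i ∈ Finset.range n, lam.rowLen i := by
      rw [← Finset.sum_add_distrib]
      exact Finset.sum_congr rfl fun i _ => Nat.sub_add_cancel (ha.2.1 i).1
    rw [h1, card_eq_sum_rowLen lam hl, card_eq_sum_rowLen a ha.2.2, Finset.sum_range_succ, expo]
    simp only [Fin.val_zero, add_zero, Nat.add_sub_cancel, Nat.sub_zero]
    omega

theorem alt_mul_sch {lam : YoungDiagram} {n : ℕ} (hl : lam.rowLen n = 0) (x : Fin n → A) :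
    alt (fun j => (j : ℕ)) x * sch lam x = alt (expo lam n) x := by
  induction n generalizing lam with
  | zero => simp [sch_zero hl, alt]
  | succ n ih =>
    rw [alt_expo_succ hl, alt_val_succ, sch_succ, mul_assoc]
    congr 1
    rw [Finset.mul_sum, ← Finset.filter_filter]
    refine (Finset.sum_congr rfl fun a _ => ?_).trans (Finset.sum_filter _ _).symm
    split_ifs with h
    · rw [← ih h]
      ring
    · rw [sch_eq_zero h]
      ring

end Bialternant

section DualCauchy

variable {A : Type*} [CommRing A]

theorem alt_eq_zero {n : ℕ} {l : Fin n → ℕ} {i j : Fin n} (hij : i ≠ j) (h : l i = l j)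
    (x : Fin n → A) : alt l x = 0 := by
  refine Matrix.det_zero_of_row_eq hij ?_
  funext k
  simp [h]

theorem alt_mul_prod_add {n : ℕ} (l : Fin n → ℕ) (x : Fin n → A) (t : A) :
    alt l x * ∏ i, (x i + t) =
      ∑ p ∈ Fintype.piFinset (fun j : Fin n => Finset.Icc (l j) (l j + 1)),
        (∏ j : Fin n, t ^ (l j + 1 - p j)) * alt p x := by
  have h1 : ∀ p : Fin n → ℕ, (∏ j : Fin n, t ^ (l j + 1 - p j)) * alt p x =
      Matrix.det (Matrix.of fun j i : Fin n => t ^ (l j + 1 - p j) * x i ^ p j) :=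
    fun p => (Matrix.det_mul_column _ _).symm
  simp only [h1]
  rw [← det_sum_rows (fun j : Fin n => Finset.Icc (l j) (l j + 1))
    (fun j m i => t ^ (l j + 1 - m) * x i ^ m), mul_comm, alt, ← Matrix.det_mul_row]
  congr 1
  ext j i
  have : Finset.Icc (l j) (l j + 1) = {l j, l j + 1} := by
    ext m
    simp only [Finset.mem_Icc, Finset.mem_insert, Finset.mem_singleton]
    omega
  simp only [Matrix.of_apply]
  rw [this, Finset.sum_pair (by omega)]
  simp only [Nat.add_sub_cancel_left, Nat.sub_self]
  ring

theorem horizontalStrip_iff_colLen {a b : YoungDiagram} :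
    HorizontalStrip a b ↔ ∀ j, a.colLen j ≤ b.colLen j ∧ b.colLen j ≤ a.colLen j + 1 := by
  rw [HorizontalStrip, le_iff_colLen, forall_and]
  refine and_congr_right fun _ => ?_
  simp only [YoungDiagram.mem_iff_lt_colLen]
  constructor
  · intro h j
    by_contra! hc
    have := h (a.colLen j) j hc
    omega
  · intro h i j hij
    have := h j
    omega

/-- The exponents complementary to the column lengths of a diagram. -/
def coExpo (mu : YoungDiagram) (f n : ℕ) (j : Fin n) : ℕ :=
  f - mu.colLen j + j

theorem coExpo_injOn {f n : ℕ} : Set.InjOn (fun mu => coExpo mu f n) (below (rect f n)) := by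
  intro a ha b hb h
  rw [Finset.mem_coe, mem_below] at ha hb
  have ha' := le_iff_colLen.1 ha
  have hb' := le_iff_colLen.1 hb
  rw [← YoungDiagram.transpose_eq_iff]
  refine ext_rowLen fun j => ?_
  rw [YoungDiagram.rowLen_transpose, YoungDiagram.rowLen_transpose]
  specialize ha' j
  specialize hb' j
  rw [← YoungDiagram.rowLen_transpose (rect f n), rect_transpose, rowLen_rect] at ha' hb'
  split_ifs at ha' hb' with hj
  · have := congrFun h ⟨j, hj⟩
    simp only [coExpo] at this
    omega
  · omega

theorem alt_coExpo_mul_prod_add {a : YoungDiagram} {f n : ℕ} (ha : a ≤ rect f n)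
    (x : Fin n → A) (t : A) :
    alt (coExpo a f n) x * ∏ i, (x i + t) =
      ∑ b ∈ (below (rect (f + 1) n)).filter (fun b => HorizontalStrip a b),
        alt (coExpo b (f + 1) n) x * t ^ (b.card - a.card) := by
  have hrect : ∀ r j, (rect r n).colLen j = if j < n then r else 0 := fun r j => by
    rw [← YoungDiagram.rowLen_transpose, rect_transpose, rowLen_rect]
  have hcol : ∀ j, a.colLen j ≤ if j < n then f else 0 := fun j => by
    rw [← hrect]
    exact le_iff_colLen.1 ha j
  have hcolb : ∀ b ∈ (below (rect (f + 1) n)).filter (fun b => HorizontalStrip a b), ∀ j,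
      b.colLen j ≤ if j < n then f + 1 else 0 := fun b hb j => by
    rw [← hrect]
    exact le_iff_colLen.1 (mem_below.1 (Finset.mem_filter.1 hb).1) j
  have hstrip : ∀ b ∈ (below (rect (f + 1) n)).filter (fun b => HorizontalStrip a b), ∀ j,
      a.colLen j ≤ b.colLen j ∧ b.colLen j ≤ a.colLen j + 1 := fun b hb =>
    horizontalStrip_iff_colLen.1 (Finset.mem_filter.1 hb).2
  rw [alt_mul_prod_add]
  symm
  refine Finset.sum_of_injOn (fun b => coExpo b (f + 1) n) ?_ ?_ ?_ ?_
  · exact coExpo_injOn.mono (Finset.coe_subset.2 (Finset.filter_subset _ _))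
  · intro b hb
    rw [Finset.mem_coe] at hb
    rw [Finset.mem_coe, Fintype.mem_piFinset]
    intro j
    have h1 := hcol j
    have h2 := hstrip b hb j
    rw [if_pos j.2] at h1
    simp only [Finset.mem_Icc, coExpo]
    omega
  · intro p hp hne
    rw [Fintype.mem_piFinset] at hp
    suffices h : ∃ i j, i ≠ j ∧ p i = p j by
      obtain ⟨i, j, hij, h⟩ := h
      rw [alt_eq_zero hij h, mul_zero]
    by_contra! hinj
    have hp' : ∀ j (h : j < n), f - a.colLen j + j ≤ p ⟨j, h⟩ ∧
        p ⟨j, h⟩ ≤ f - a.colLen j + j + 1 := fun j h => by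
      simpa only [Finset.mem_Icc, coExpo] using hp ⟨j, h⟩
    let c : ℕ → ℕ := fun j => if h : j < n then f + 1 + j - p ⟨j, h⟩ else 0
    have hn : c n = 0 := dif_neg (lt_irrefl n)
    have hanti : Antitone c := by
      refine antitone_nat_of_succ_le fun j => ?_
      simp only [c]
      split_ifs with h1 h2
      · have h3 := hp' j h2
        have h4 := hp' (j + 1) h1
        have h5 := hcol j
        rw [if_pos h2] at h5
        have h6 := a.colLen_anti j (j + 1) j.le_succ
        have h7 := hinj ⟨j, h2⟩ ⟨j + 1, h1⟩ (by simp)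
        omega
      · omega
      · exact Nat.zero_le _
      · exact le_rfl
    have hb : ∀ j, (ofRows c hanti n).transpose.colLen j = c j := fun j => by
      rw [← YoungDiagram.rowLen_transpose, YoungDiagram.transpose_transpose,
        rowLen_ofRows c hanti hn]
    refine hne ⟨(ofRows c hanti n).transpose, ?_, ?_⟩
    · rw [Finset.mem_coe, Finset.mem_filter, mem_below, le_iff_colLen, horizontalStrip_iff_colLen]
      simp only [hb, hrect, c]
      refine ⟨fun j => ?_, fun j => ?_⟩
      · split_ifs with h
        · have := hp' j h
          omega
        · exact le_rfl
      · have h1 := hcol j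
        split_ifs at h1 ⊢ with h
        · have := hp' j h
          omega
        · omega
    · funext j
      have h1 := hp' j j.2
      have h2 := hcol j
      rw [if_pos j.2] at h2
      simp only [coExpo, hb, c]
      rw [dif_pos j.2]
      simp only [Fin.eta] at h1 ⊢
      omega
  · intro b hb
    rw [mul_comm, Finset.prod_pow_eq_pow_sum]
    congr 2
    have h1 : ∀ d : YoungDiagram, ∀ r, (∀ j, d.colLen j ≤ if j < n then r else 0) →
        d.card = ∑ j : Fin n, d.colLen j := fun d r h => by
      rw [Fin.sum_univ_eq_sum_range, card_eq_sum_colLen]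
      simpa using h n
    have h2 : ∑ j, (coExpo a f n j + 1 - coExpo b (f + 1) n j) + ∑ j : Fin n, a.colLen j =
        ∑ j : Fin n, b.colLen j := by
      rw [← Finset.sum_add_distrib]
      refine Finset.sum_congr rfl fun j _ => ?_
      have h3 := hcol j
      have h4 := hcolb b hb j
      have h5 := hstrip b hb j
      rw [if_pos j.2] at h3 h4
      rw [coExpo, coExpo]
      omega
    rw [h1 a f hcol, h1 b (f + 1) (hcolb b hb)]
    omega

theorem dual_cauchy {e f : ℕ} (x : Fin e → A) (y : Fin f → A) :
    alt (fun j => (j : ℕ)) x * ∏ i, ∏ j, (x i + y j) =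
      ∑ mu ∈ below (rect f e), alt (coExpo mu f e) x * sch mu y := by
  induction f with
  | zero =>
    have h : below (rect 0 e) = {⊥} := by
      ext a
      rw [mem_below, Finset.mem_singleton, ← le_bot_iff]
      constructor
      · rintro h ⟨i, j⟩ hc
        have := h hc
        rw [mem_rect] at this
        omega
      · intro h
        exact h.trans bot_le
    have h0 : (⊥ : YoungDiagram).rowLen 0 = 0 := by
      by_contra h
      have : (0, 0) ∈ (⊥ : YoungDiagram) :=
        YoungDiagram.mem_iff_lt_rowLen.2 (Nat.pos_of_ne_zero h)
      exact YoungDiagram.notMem_bot _ this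
    rw [h, Finset.sum_singleton, sch_zero h0]
    simp only [Finset.univ_eq_empty, Finset.prod_empty, Finset.prod_const_one, mul_one]
    congr 1
    funext j
    simp [coExpo]
  | succ f ih =>
    have h1 : ∏ i, ∏ j, (x i + y j) =
        (∏ i, ∏ j : Fin f, (x i + y j.castSucc)) * ∏ i, (x i + y (Fin.last f)) := by
      rw [← Finset.prod_mul_distrib]
      exact Finset.prod_congr rfl fun i _ => Fin.prod_univ_castSucc _
    rw [h1, ← mul_assoc, ih (fun j => y j.castSucc), Finset.sum_mul]
    have h2 : ∀ a ∈ below (rect f e), alt (coExpo a f e) x * sch a (fun j => y j.castSucc) *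
        ∏ i, (x i + y (Fin.last f)) =
        ∑ b ∈ (below (rect (f + 1) e)).filter (fun b => HorizontalStrip a b),
          alt (coExpo b (f + 1) e) x *
            (sch a (fun j => y j.castSucc) * y (Fin.last f) ^ (b.card - a.card)) := by
      intro a ha
      rw [mul_right_comm, alt_coExpo_mul_prod_add (mem_below.1 ha), Finset.sum_mul]
      exact Finset.sum_congr rfl fun b _ => by ring
    rw [Finset.sum_congr rfl h2, Finset.sum_comm' (t' := below (rect (f + 1) e))
      (s' := fun b => ((below b).filter (fun a => HorizontalStrip a b)).filter
        (fun a => a.rowLen f = 0))]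
    · refine Finset.sum_congr rfl fun b _ => ?_
      rw [sch_succ, Finset.mul_sum]
      refine Finset.sum_filter_of_ne fun a _ h => ?_
      by_contra h0
      rw [sch_eq_zero h0] at h
      simp at h
    · intro a b
      simp only [Finset.mem_filter, mem_below]
      constructor
      · rintro ⟨h1, h2, h3⟩
        exact ⟨⟨⟨h3.1, h3⟩, (le_rect_iff.1 h1).1⟩, h2⟩
      · rintro ⟨⟨⟨h1, h2⟩, h3⟩, h4⟩
        refine ⟨le_rect_iff.2 ⟨h3, ?_⟩, h4, h2⟩
        exact (le_rect_iff.1 (h1.trans h4)).2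

end DualCauchy

section Derivative

open Polynomial

variable {A : Type*} [CommRing A]

theorem derivative_alt {n : ℕ} (l : Fin n → ℕ) (z : Fin n → A[X])
    (hz : ∀ i, derivative (z i) = -1) : derivative (alt l z) =
      -∑ k, (l k : A[X]) * alt (Function.update l k (l k - 1)) z := by
  have h : ∀ l : Fin n → ℕ, alt l z =
      ∑ σ : Equiv.Perm (Fin n), ((Equiv.Perm.sign σ : ℤ) : A[X]) * ∏ j, z (σ j) ^ l j := by
    intro l
    rw [alt, ← Matrix.det_transpose, Matrix.det_apply']
    rfl
  simp only [h, Finset.mul_sum, ← Finset.sum_neg_distrib]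
  rw [derivative_sum, Finset.sum_comm]
  refine Finset.sum_congr rfl fun σ _ => ?_
  rw [derivative_intCast_mul, derivative_prod_finset, Finset.mul_sum]
  refine Finset.sum_congr rfl fun k _ => ?_
  rw [derivative_pow, hz, ← Finset.mul_prod_erase _ _ (Finset.mem_univ k), Function.update_self]
  have : ∏ j ∈ Finset.univ.erase k, z (σ j) ^ Function.update l k (l k - 1) j =
      ∏ j ∈ Finset.univ.erase k, z (σ j) ^ l j :=
    Finset.prod_congr rfl fun j hj => by
      rw [Function.update_of_ne (Finset.ne_of_mem_erase hj)]
  rw [this, map_natCast]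
  ring

theorem exists_update_expo {a b : YoungDiagram} {n : ℕ} (hb : b.rowLen n = 0) (h : Cov a b) :
    ∃ j : Fin n, expo a n = Function.update (expo b n) j (expo b n j - 1) ∧
      expo b n j ≠ 0 ∧ skewContPoly n b a = expo b n j := by
  obtain ⟨k, hk⟩ := cov_iff_rowLen.1 h
  have hkn : k < n := by
    by_contra! hc
    have h1 := b.rowLen_anti n k hc
    have h2 := hk k
    rw [if_pos rfl] at h2
    omega
  have hj : n - 1 - (n - 1 - k) = k := by omega
  have hkk := hk k
  rw [if_pos rfl] at hkk
  have hlt : n - 1 - k < n := by omega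
  refine ⟨⟨n - 1 - k, hlt⟩, ?_, ?_, ?_⟩
  · funext i
    have hi := i.2
    have hki := hk (n - 1 - i)
    rcases eq_or_ne i ⟨n - 1 - k, hlt⟩ with rfl | hne
    · rw [Function.update_self]
      simp only [expo, hj]
      omega
    · rw [Function.update_of_ne hne]
      have : (i : ℕ) ≠ n - 1 - k := fun h => hne (Fin.ext h)
      rw [if_neg (by omega)] at hki
      simp only [expo]
      omega
  · simp only [expo, hj]
    omega
  · rw [skewContPoly_cov n hk]
    simp only [expo, hj]
    rw [hkk, Nat.cast_add, Nat.cast_sub (by omega), Nat.cast_sub (by omega)]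
    push_cast
    ring

theorem exists_cov_of_expo {b : YoungDiagram} {n : ℕ} (hb : b.rowLen n = 0) {j : Fin n}
    (h0 : expo b n j ≠ 0) (h : ∀ i, i ≠ j → expo b n i ≠ expo b n j - 1) :
    ∃ a, Cov a b ∧ expo a n = Function.update (expo b n) j (expo b n j - 1) := by
  have hjn := j.2
  set k := n - 1 - (j : ℕ) with hk
  have hlt : b.rowLen (k + 1) < b.rowLen k := by
    rcases Nat.eq_zero_or_pos (j : ℕ) with hj | hj
    · rw [show k + 1 = n by omega, hb]
      rw [expo, ← hk] at h0
      omega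
    · have h1 := h ⟨j - 1, by omega⟩ (fun h => by rw [Fin.ext_iff] at h; simp only at h; omega)
      simp only [expo, ← hk] at h1
      rw [show n - 1 - ((j : ℕ) - 1) = k + 1 by omega] at h1
      have h2 := b.rowLen_anti k (k + 1) k.le_succ
      omega
  let r : ℕ → ℕ := fun i => if i = k then b.rowLen i - 1 else b.rowLen i
  have hr : Antitone r := by
    refine antitone_nat_of_succ_le fun i => ?_
    have := b.rowLen_anti i (i + 1) i.le_succ
    simp only [r]
    split_ifs with h1 h2 h2
    · omega
    · omega
    · subst h2
      omega
    · omega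
  have hn : r n = 0 := by
    simp only [r]
    rw [if_neg (by omega), hb]
  have hcov : Cov (ofRows r hr n) b := by
    refine cov_iff_rowLen.2 ⟨k, fun i => ?_⟩
    rw [rowLen_ofRows r hr hn]
    simp only [r]
    split_ifs with h
    · subst h
      omega
    · rfl
  refine ⟨ofRows r hr n, hcov, ?_⟩
  funext i
  have hi := i.2
  rcases eq_or_ne i j with rfl | hne
  · rw [Function.update_self, expo, expo, rowLen_ofRows r hr hn, ← hk]
    simp only [r]
    rw [if_pos trivial]
    omega
  · rw [Function.update_of_ne hne, expo, expo, rowLen_ofRows r hr hn]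
    simp only [r]
    rw [if_neg]
    have : (i : ℕ) ≠ j := fun h => hne (Fin.ext h)
    omega

theorem sum_expo_mul_alt [Algebra ℚ A] {b : YoungDiagram} {n : ℕ} (hb : b.rowLen n = 0)
    (z : Fin n → A) :
    ∑ k, (expo b n k : A) * alt (Function.update (expo b n) k (expo b n k - 1)) z =
      ∑ a ∈ downs b, algebraMap ℚ A (skewContPoly n b a) * alt (expo a n) z := by
  have hJ : ∀ a ∈ downs b, ∃ j : Fin n,
      expo a n = Function.update (expo b n) j (expo b n j - 1) ∧
      expo b n j ≠ 0 ∧ skewContPoly n b a = expo b n j := fun a ha =>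
    exists_update_expo hb (mem_downs.1 ha)
  choose J hJ using hJ
  have hrow : ∀ a, Cov a b → a.rowLen n = 0 := fun a h => by
    have := le_iff_rowLen.1 h.1 n
    omega
  have hval : ∀ a (ha : a ∈ downs b), algebraMap ℚ A (skewContPoly n b a) * alt (expo a n) z =
      (expo b n (J a ha) : A) *
        alt (Function.update (expo b n) (J a ha) (expo b n (J a ha) - 1)) z := by
    intro a ha
    rw [(hJ a ha).2.2, ← (hJ a ha).1, map_natCast]
  symm
  refine Finset.sum_bij_ne_zero (fun a ha _ => J a ha) ?_ ?_ ?_ ?_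
  · intros
    exact Finset.mem_univ _
  · intro a ha _ a' ha' _ h
    have h1 := (hJ a ha).1
    rw [h, ← (hJ a' ha').1] at h1
    exact expo_injective (hrow a (mem_downs.1 ha)) (hrow a' (mem_downs.1 ha')) h1
  · intro j _ hj
    have h0 : expo b n j ≠ 0 := fun h => hj (by rw [h, Nat.cast_zero, zero_mul])
    obtain ⟨a, ha, hexp⟩ := exists_cov_of_expo hb h0 fun i hi h => hj (by
      rw [alt_eq_zero hi (by rw [Function.update_self, Function.update_of_ne hi, h]), mul_zero])
    have ha' := mem_downs.2 ha
    have hJj : J a ha' = j := by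
      by_contra hne
      have h1 := congrFun ((hJ a ha').1.symm.trans hexp) j
      rw [Function.update_self, Function.update_of_ne (Ne.symm hne)] at h1
      omega
    refine ⟨a, ha', ?_, hJj⟩
    rw [hval a ha', hJj]
    exact hj
  · intro a ha _
    exact hval a ha

end Derivative

section Complement

theorem add_colLen_eq_iff {lam mu : YoungDiagram} {e f : ℕ} (hl : lam ≤ rect e f)
    (hm : mu ≤ rect f e) : (∀ i < f, mu.rowLen i + lam.colLen (f - 1 - i) = e) ↔
      ∀ i < f, ∀ j < e, ((i, j) ∈ mu ↔ (e - 1 - j, f - 1 - i) ∉ lam) := by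
  refine forall₂_congr fun i hi => ?_
  have h1 := le_iff_rowLen.1 hm i
  have h2 := le_iff_colLen.1 hl (f - 1 - i)
  rw [rowLen_rect, if_pos hi] at h1
  rw [← YoungDiagram.rowLen_transpose (rect e f), rect_transpose, rowLen_rect,
    if_pos (by omega)] at h2
  simp only [YoungDiagram.mem_iff_lt_rowLen (μ := mu), YoungDiagram.mem_iff_lt_colLen (μ := lam)]
  constructor
  · intro h j hj
    omega
  · intro h
    by_contra hne
    have h3 := h (mu.rowLen i)
    have h4 := h (mu.rowLen i - 1)
    omega

theorem add_colLen_eq_iff_expo {lam mu : YoungDiagram} {e f : ℕ} (hl : lam ≤ rect e f)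
    (hm : mu ≤ rect f e) : (∀ i < f, mu.rowLen i + lam.colLen (f - 1 - i) = e) ↔
      expo lam e = coExpo mu f e := by
  have hl' : lam.transpose ≤ rect f e := by
    rw [← rect_transpose, YoungDiagram.transpose_le_iff]
    exact hl
  have hm' : mu.transpose ≤ rect e f := by
    rw [← rect_transpose, YoungDiagram.transpose_le_iff]
    exact hm
  have h := add_colLen_eq_iff hl' hm'
  simp only [YoungDiagram.rowLen_transpose, YoungDiagram.colLen_transpose,
    YoungDiagram.mem_transpose, Prod.swap_prod_mk] at h
  rw [add_colLen_eq_iff hl hm]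
  refine Iff.trans ⟨fun h j hj i hi => h i hi j hj, fun h i hi j hj => h j hj i hi⟩
    (h.symm.trans ?_)
  rw [funext_iff, Fin.forall_iff]
  refine forall₂_congr fun j hj => ?_
  have h1 := le_iff_colLen.1 hm j
  rw [← YoungDiagram.rowLen_transpose (rect f e), rect_transpose, rowLen_rect, if_pos hj] at h1
  simp only [expo, coExpo]
  omega

theorem exists_expo_eq_coExpo {mu : YoungDiagram} {e f : ℕ} :
    ∃ lam, lam ≤ rect e f ∧ expo lam e = coExpo mu f e := by
  let r : ℕ → ℕ := fun i => if i < e then f - mu.colLen (e - 1 - i) else 0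
  have hr : Antitone r := by
    refine antitone_nat_of_succ_le fun i => ?_
    have := mu.colLen_anti (e - 1 - (i + 1)) (e - 1 - i) (by omega)
    simp only [r]
    split_ifs <;> omega
  have hn : r e = 0 := if_neg (lt_irrefl e)
  refine ⟨ofRows r hr e, ?_, ?_⟩
  · rw [le_iff_rowLen]
    intro i
    rw [rowLen_ofRows r hr hn, rowLen_rect]
    simp only [r]
    split_ifs <;> omega
  · funext j
    have hj := j.2
    rw [expo, coExpo, rowLen_ofRows r hr hn]
    simp only [r]
    rw [if_pos (by omega), show e - 1 - (e - 1 - (j : ℕ)) = j by omega]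

theorem card_add_card_of_expo_eq {lam mu : YoungDiagram} {e f : ℕ} (hl : lam ≤ rect e f)
    (hm : mu ≤ rect f e) (h : expo lam e = coExpo mu f e) : lam.card + mu.card = e * f := by
  rw [card_eq_sum_rowLen lam (le_rect_iff.1 hl).1, card_eq_sum_colLen mu (le_rect_iff.1 hm).2,
    ← Finset.sum_range_reflect, ← Finset.sum_add_distrib,
    Finset.sum_congr rfl (g := fun _ => f) fun j hj => ?_]
  · simp
  · rw [Finset.mem_range] at hj
    have h1 := congrFun h ⟨j, hj⟩
    have h2 := le_iff_colLen.1 hm j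
    rw [← YoungDiagram.rowLen_transpose (rect f e), rect_transpose, rowLen_rect, if_pos hj] at h2
    simp only [expo, coExpo] at h1
    omega

end Complement

section Deformation

open Polynomial

variable {A : Type*} [CommRing A] [Algebra ℚ A]

/-- The part indexed by `mu` of a polynomial interpolating between the two sides of the
expansion of the Chern class. -/
def deform (e f : ℕ) (mu : YoungDiagram) (z : Fin e → A[X]) : A[X] :=
  ∑ lam ∈ below (rect e f), algebraMap ℚ A[X] (P lam mu e f) *
    X ^ (e * f - mu.card - lam.card) * alt (expo lam e) z

theorem derivative_algebraMap_mul_X_pow_mul (q : ℚ) (d : ℕ) (g : A[X]) :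
    derivative (algebraMap ℚ A[X] q * X ^ d * g) =
      algebraMap ℚ A[X] q * (d : A[X]) * X ^ (d - 1) * g +
        algebraMap ℚ A[X] q * X ^ d * derivative g := by
  rw [Polynomial.algebraMap_apply, derivative_mul, derivative_C_mul, derivative_X_pow, map_natCast]
  ring

theorem derivative_deform {e f : ℕ} {mu : YoungDiagram} (hm : mu ≤ rect f e)
    (z : Fin e → A[X]) (hz : ∀ i, derivative (z i) = -1) : derivative (deform e f mu z) = 0 := by
  have hmf := (le_rect_iff.1 hm).1
  have h1 : ∀ lam ∈ below (rect e f), derivative (algebraMap ℚ A[X] (P lam mu e f) *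
      X ^ (e * f - mu.card - lam.card) * alt (expo lam e) z) =
      algebraMap ℚ A[X] ((e * f - lam.card - mu.card : ℚ) * P lam mu e f) *
        X ^ (e * f - mu.card - lam.card - 1) * alt (expo lam e) z -
      ∑ a ∈ downs lam, algebraMap ℚ A[X] (skewContPoly e lam a * P lam mu e f) *
        X ^ (e * f - mu.card - lam.card) * alt (expo a e) z := by
    intro lam hlam
    have hle := (le_rect_iff.1 (mem_below.1 hlam)).1
    have hd : (algebraMap ℚ A[X] (P lam mu e f)) * ((e * f - mu.card - lam.card : ℕ) : A[X]) =
        algebraMap ℚ A[X] ((e * f - lam.card - mu.card : ℚ) * P lam mu e f) := by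
      by_cases h0 : P lam mu e f = 0
      · simp [h0]
      · obtain ⟨-, -, hc⟩ := P_support hle hmf h0
        have hq : ((e * f - mu.card - lam.card : ℕ) : ℚ) = e * f - lam.card - mu.card := by
          rw [Nat.cast_sub (by omega), Nat.cast_sub (by omega)]
          push_cast
          ring
        rw [← hq, map_mul, map_natCast, mul_comm]
    rw [derivative_algebraMap_mul_X_pow_mul, derivative_alt _ _ hz, sum_expo_mul_alt hle, hd,
      mul_neg, ← sub_eq_add_neg, Finset.mul_sum]
    refine congrArg (_ - ·) (Finset.sum_congr rfl fun a _ => ?_)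
    rw [map_mul]
    ring
  rw [deform, derivative_sum, Finset.sum_congr rfl h1, Finset.sum_sub_distrib, sub_eq_zero]
  rw [Finset.sum_comm' (t' := below (rect e f))
    (s' := fun a => (ups a).filter (fun lam => lam ≤ rect e f))]
  · refine Finset.sum_congr rfl fun a ha => ?_
    have hle := (le_rect_iff.1 (mem_below.1 ha)).1
    have h2 : ∀ lam ∈ (ups a).filter (fun lam => lam ≤ rect e f),
        algebraMap ℚ A[X] (skewContPoly e lam a * P lam mu e f) *
          X ^ (e * f - mu.card - lam.card) * alt (expo a e) z =
        algebraMap ℚ A[X] (skewContPoly e lam a * P lam mu e f) *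
          (X ^ (e * f - mu.card - a.card - 1) * alt (expo a e) z) := by
      intro lam hlam
      rw [Finset.mem_filter, mem_ups] at hlam
      rw [hlam.1.2, ← Nat.sub_sub, mul_assoc]
    rw [Finset.sum_congr rfl h2, ← Finset.sum_mul, ← map_sum, ← sum_ups_P, mul_assoc]
    congr 2
    symm
    refine Finset.sum_filter_of_ne fun lam _ h => ?_
    by_contra hc
    by_cases h0 : lam.rowLen e = 0
    · exact hc (P_support h0 hmf (right_ne_zero_of_mul h)).1
    · exact left_ne_zero_of_mul h (skewContPoly_eq_zero hle h0)
  · intro lam a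
    simp only [mem_below, mem_downs, mem_ups, Finset.mem_filter]
    constructor
    · rintro ⟨h, hc⟩
      exact ⟨⟨hc, h⟩, hc.1.trans h⟩
    · rintro ⟨⟨hc, h⟩, -⟩
      exact ⟨h, hc⟩

theorem eval_one_deform {e f : ℕ} {mu : YoungDiagram} (z : Fin e → A[X]) :
    (deform e f mu z).eval 1 = ∑ lam ∈ below (rect e f), algebraMap ℚ A (P lam mu e f) *
      alt (expo lam e) (fun i => (z i).eval 1) := by
  rw [deform, eval_finsetSum]
  refine Finset.sum_congr rfl fun lam _ => ?_
  rw [eval_mul, eval_mul, eval_pow, eval_X, one_pow, mul_one, ← coe_evalRingHom, map_alt,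
    IsScalarTower.algebraMap_apply ℚ A A[X], algebraMap_eq, coe_evalRingHom, eval_C]

theorem eval_zero_deform {e f : ℕ} {mu : YoungDiagram} (hm : mu ≤ rect f e) (z : Fin e → A[X]) :
    (deform e f mu z).eval 0 = alt (coExpo mu f e) (fun i => (z i).eval 0) := by
  obtain ⟨lam, hl, hexp⟩ := exists_expo_eq_coExpo (mu := mu) (e := e) (f := f)
  have hcard := card_add_card_of_expo_eq hl hm hexp
  rw [deform, eval_finsetSum, Finset.sum_eq_single lam]
  · rw [P_top hl hm hcard, if_pos ((add_colLen_eq_iff_expo hl hm).2 hexp),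
      show e * f - mu.card - lam.card = 0 by omega, map_one, pow_zero, mul_one, one_mul,
      ← coe_evalRingHom, map_alt, hexp]
  · intro a ha hne
    rw [mem_below] at ha
    rcases lt_trichotomy (a.card + mu.card) (e * f) with h | h | h
    · rw [eval_mul, eval_mul, eval_pow, eval_X, zero_pow (by omega)]
      ring
    · rw [P_top ha hm h, if_neg]
      · simp
      · rw [add_colLen_eq_iff_expo ha hm, ← hexp]
        exact fun h' => hne (expo_injective (le_rect_iff.1 ha).1 (le_rect_iff.1 hl).1 h')
    · have h0 : P a mu e f = 0 := by
        by_contra h0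
        have := (P_support (le_rect_iff.1 ha).1 (le_rect_iff.1 hm).1 h0).2.2
        omega
      simp [h0]
  · intro h
    exact absurd (mem_below.2 hl) h

theorem alt_coExpo_add_one [IsDomain A] {e f : ℕ} {mu : YoungDiagram} (hm : mu ≤ rect f e)
    (x : Fin e → A) : alt (coExpo mu f e) (fun i => x i + 1) =
      ∑ lam ∈ below (rect e f), algebraMap ℚ A (P lam mu e f) * alt (expo lam e) x := by
  have : CharZero A := algebraRat.charZero A
  let z : Fin e → A[X] := fun i => C (x i + 1) - X
  have hz : ∀ i, derivative (z i) = -1 := fun i => by simp [z]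
  have h := eq_C_of_derivative_eq_zero (derivative_deform hm z hz)
  have h0 := eval_zero_deform hm z
  have h1 := eval_one_deform (f := f) (mu := mu) z
  rw [h, eval_C] at h0 h1
  rw [h0] at h1
  simpa [z] using h1

theorem vandermonde_mul_prod [IsDomain A] {e f : ℕ} (x : Fin e → A) (y : Fin f → A) :
    (Matrix.vandermonde x).det * ∏ i, ∏ j, (1 + x i + y j) =
      (Matrix.vandermonde x).det * ∑ lam ∈ below (rect e f), ∑ mu ∈ below (rect f e),
        algebraMap ℚ A (P lam mu e f) * sch lam x * sch mu y := by
  have h := dual_cauchy (fun i => x i + 1) y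
  rw [alt_val_eq_det_vandermonde, Matrix.det_vandermonde_add] at h
  simp only [add_comm (1 : A)]
  rw [h, Finset.sum_comm, Finset.mul_sum]
  refine Finset.sum_congr rfl fun mu hmu => ?_
  rw [alt_coExpo_add_one (mem_below.1 hmu), Finset.sum_mul, Finset.mul_sum]
  refine Finset.sum_congr rfl fun lam hlam => ?_
  rw [← alt_mul_sch (le_rect_iff.1 (mem_below.1 hlam)).1, alt_val_eq_det_vandermonde]
  ring

theorem prod_one_add_add {e f : ℕ} (x : Fin e → ℚ) (y : Fin f → ℚ) :
    ∏ i, ∏ j, (1 + x i + y j) = ∑ lam ∈ below (rect e f), ∑ mu ∈ below (rect f e),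
      P lam mu e f * schur lam x * schur mu y := by
  let x' : Fin e → ℚ[X] := fun i => C (x i) + C (i : ℚ) * X
  let y' : Fin f → ℚ[X] := fun j => C (y j)
  have hinj : Function.Injective x' := by
    intro i j h
    have := congrArg (fun p : ℚ[X] => p.coeff 1) h
    simp only [x', coeff_add, coeff_C_mul, coeff_X_one, coeff_C_succ, mul_one, zero_add] at this
    exact Fin.ext (by exact_mod_cast this)
  have h := mul_left_cancel₀ (Matrix.det_vandermonde_ne_zero_iff.2 hinj)
    (vandermonde_mul_prod x' y')
  have h2 := congrArg (evalRingHom (0 : ℚ)) h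
  simp only [map_prod, map_sum, map_mul, map_add, map_one, map_sch] at h2
  simpa [x', y', schur_eq_sch] using h2

end Deformation

/-- Theorem 1 of the paper, on Chern roots:
`∏_{i,j}(1 + xᵢ + yⱼ) = ∑_{λ,μ} P_{λ,μ}(e,f) s_λ(x) s_μ(y)`. -/
theorem chern_class_tensor (e f : ℕ) (x : Fin e → ℚ) (y : Fin f → ℚ) :
    (∏ i, ∏ j, (1 + x i + y j)) =
    ∑ᶠ lam : YoungDiagram, ∑ᶠ mu : YoungDiagram,
      P lam mu (e : ℚ) (f : ℚ) * schur lam x * schur mu y := by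
  have hrow : ∀ {n : ℕ} {lam : YoungDiagram} {z : Fin n → ℚ}, schur lam z ≠ 0 →
      lam.rowLen n = 0 := fun {n lam z} h => by
    by_contra h0
    exact h (by rw [schur_eq_sch, sch_eq_zero h0])
  have hsupp : ∀ lam mu : YoungDiagram, P lam mu (e : ℚ) (f : ℚ) * schur lam x * schur mu y ≠ 0 →
      lam ≤ rect e f ∧ mu ≤ rect f e := fun lam mu h => by
    have h1 := left_ne_zero_of_mul h
    obtain ⟨hl, hm, -⟩ := P_support (hrow (right_ne_zero_of_mul h1))
      (hrow (right_ne_zero_of_mul h)) (left_ne_zero_of_mul h1)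
    exact ⟨hl, hm⟩
  have hin : ∀ lam : YoungDiagram,
      ∑ᶠ mu : YoungDiagram, P lam mu (e : ℚ) (f : ℚ) * schur lam x * schur mu y =
        ∑ mu ∈ below (rect f e), P lam mu (e : ℚ) (f : ℚ) * schur lam x * schur mu y :=
    fun lam => finsum_eq_sum_of_support_subset _ fun mu h => by
      rw [Finset.mem_coe, mem_below]
      exact (hsupp lam mu h).2
  simp only [hin]
  rw [prod_one_add_add]
  symm
  refine finsum_eq_sum_of_support_subset _ fun lam h => ?_
  obtain ⟨mu, -, h⟩ := Finset.exists_ne_zero_of_sum_ne_zero h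
  rw [Finset.mem_coe, mem_below]
  exact (hsupp lam mu h).1

end ChernTensor
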